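/- arXiv:1901.03436 — 6 statements merged into one kernel-verified Lean document; each statement's English description precedes it below -/
import Mathlib

section
/- If x, y ∈ ℚ satisfy y² = (x² + x − 1)(x⁶ − 5x⁵ − 9x³ − 5x − 1), then x = 0 and y = 1 or y = −1. (Equivalently, the only affine rational points on this model of X₀(35) are the two finite cusps.) -/
open NumberField in
/-- If the norm of a primitive Eisenstein integer `g + h * ω` is a cube prime to `3`, then
`g + h * ω` is a cube up to a power of `ω`. -/
theorem exists_eisenstein_cube {g h l : ℤ} (hgh : IsCoprime g h) (hl : ¬ 3 ∣ l)
    (heq : g ^ 2 - g * h + h ^ 2 = l ^ 3) :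
    ∃ e f c d : ℤ, c = e ^ 3 + f ^ 3 - 3 * e * f ^ 2 ∧ d = 3 * e ^ 2 * f - 3 * e * f ^ 2 ∧
      (g = c ∧ h = d ∨ g = -d ∧ h = c - d ∨ g = d - c ∧ h = -c) := by
  let K := CyclotomicField 3 ℚ
  have : IsCyclotomicExtension {3} ℚ K := CyclotomicField.isCyclotomicExtension 3 ℚ
  have : IsPrincipalIdealRing (𝓞 K) := IsCyclotomicExtension.Rat.three_pid K
  have hζ : IsPrimitiveRoot (IsCyclotomicExtension.zeta 3 ℚ K) 3 :=
    IsCyclotomicExtension.zeta_spec 3 ℚ K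
  set η := hζ.toInteger with hη
  have hη2 : η ^ 2 + η + 1 = 0 := by
    have := hζ.toInteger_isPrimitiveRoot.isRoot_cyclotomic (by norm_num)
    simpa [Polynomial.cyclotomic_three] using this
  have repr (β : 𝓞 K) : ∃ e f : ℤ, β = e + f * η := by
    obtain ⟨p, hp, rfl⟩ := hζ.integralPowerBasis.exists_eq_aeval β
    rw [hζ.integralPowerBasis_dim, Nat.totient_prime Nat.prime_three] at hp
    obtain ⟨a, b, rfl⟩ := Polynomial.exists_eq_X_add_C_of_natDegree_le_one
      (by omega : p.natDegree ≤ 1)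
    exact ⟨b, a, by simp [hη, add_comm]⟩
  have inj {a b a' b' : ℤ} (H : (a + b * η : 𝓞 K) = a' + b' * η) : a = a' ∧ b = b' := by
    have h0 : (((a - a') ^ 2 - (a - a') * (b - b') + (b - b') ^ 2 : ℤ) : 𝓞 K) = 0 := by
      push_cast
      linear_combination ((a : 𝓞 K) - a' + (b - b') * η ^ 2) * H +
        (-((a : 𝓞 K) - a') * (b - b') - (b - b') ^ 2 * (η - 1)) * hη2
    rw [Int.cast_eq_zero] at h0
    constructor <;> nlinarith [sq_nonneg (a - a'), sq_nonneg (b - b'), sq_nonneg (a - a' - (b - b'))]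
  have hnorm : ((g : 𝓞 K) + h * η) * (g + h * η ^ 2) = (l : 𝓞 K) ^ 3 := by
    have := congrArg (Int.cast : ℤ → 𝓞 K) heq
    push_cast at this
    linear_combination this + ((g : 𝓞 K) * h + h ^ 2 * (η - 1)) * hη2
  have hcop : IsCoprime ((g : 𝓞 K) + h * η) (g + h * η ^ 2) := by
    obtain ⟨s, t, hst⟩ := hgh
    obtain ⟨u, v, huv⟩ : IsCoprime (3 : ℤ) (l ^ 3) :=
      ((Int.prime_three.coprime_iff_not_dvd).2 hl).pow_right
    have hst' := congrArg (Int.cast : ℤ → 𝓞 K) hst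
    have huv' := congrArg (Int.cast : ℤ → 𝓞 K) huv
    push_cast at hst' huv'
    refine ⟨u * (-s * (η ^ 2 - η) * η ^ 2 + t * (η ^ 2 - η)) + v * (g + h * η ^ 2),
      u * (s * (η ^ 2 - η) * η - t * (η ^ 2 - η)), ?_⟩
    have h3 : (η ^ 2 - η) ^ 2 = -3 := by linear_combination (η ^ 2 - 3 * η + 3) * hη2
    linear_combination v * hnorm + huv' + 3 * u * hst' - u * (s * g + t * h) * h3
  obtain ⟨δ, u, hu⟩ := exists_associated_pow_of_mul_eq_pow' hcop hnorm
  obtain ⟨e, f, rfl⟩ := repr δ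
  have hcube : ((e : 𝓞 K) + f * η) ^ 3 = (e ^ 3 + f ^ 3 - 3 * e * f ^ 2 : ℤ) +
      (3 * e ^ 2 * f - 3 * e * f ^ 2 : ℤ) * η := by
    push_cast
    linear_combination (f ^ 3 * (η - 1) + 3 * e * f ^ 2 : 𝓞 K) * hη2
  have key := IsCyclotomicExtension.Rat.Three.Units.mem hζ u
  have hneg : (((-e : ℤ) : 𝓞 K) + (-f : ℤ) * η) ^ 3 = -((e : 𝓞 K) + f * η) ^ 3 := by
    push_cast; ring
  rw [hcube] at hu
  simp only [List.mem_cons, List.not_mem_nil, or_false] at key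
  generalize hc : e ^ 3 + f ^ 3 - 3 * e * f ^ 2 = c at hu
  generalize hd : 3 * e ^ 2 * f - 3 * e * f ^ 2 = d at hu
  obtain ⟨i, hi⟩ : ∃ i : 𝓞 K, i = u := ⟨_, rfl⟩
  rw [← hi] at hu
  have pos : (g = c ∧ h = d ∨ g = -d ∧ h = c - d ∨ g = d - c ∧ h = -c) ∨
    (g = -c ∧ h = -d ∨ g = d ∧ h = -(c - d) ∨ g = -(d - c) ∧ h = c) := by
    have hv : i = 1 ∨ i = -1 ∨ i = η ∨ i = -η ∨ i = η ^ 2 ∨ i = - η ^ 2 := by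
      rw [hi]
      rcases key with rfl | rfl | rfl | rfl | rfl | rfl <;> simp [hη]
    rcases hv with rfl | rfl | rfl | rfl | rfl | rfl
    · exact .inl (.inl (inj (by linear_combination -hu)))
    · exact .inr (.inl (inj (by push_cast; linear_combination -hu)))
    · exact .inl (.inr (.inl (inj (by push_cast; linear_combination -hu + d * hη2))))
    · exact .inr (.inr (.inl (inj (by push_cast; linear_combination -hu - d * hη2))))
    · exact .inl (.inr (.inr (inj (by push_cast; linear_combination -hu + (c + d * (η - 1)) * hη2))))
    · exact .inr (.inr (.inr (inj (by push_cast; linear_combination -hu - (c + d * (η - 1)) * hη2))))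
  rcases pos with H | H
  · exact ⟨e, f, c, d, hc.symm, hd.symm, H⟩
  · refine ⟨-e, -f, -c, -d, by rw [← hc]; ring, by rw [← hd]; ring, ?_⟩
    grind

theorem isCoprime_of_forall_prime {u v : ℤ} (hu : u ≠ 0 ∨ v ≠ 0)
    (H : ∀ p : ℤ, Prime p → p ∣ u → p ∣ v → False) : IsCoprime u v :=
  isCoprime_of_prime_dvd (by tauto) H

theorem cube_inj {u v : ℤ} (h : u ^ 3 = v ^ 3) : u = v :=
  (Odd.strictMono_pow (by decide : Odd 3)).injective h

theorem five_dvd_of_dvd_norm {g h : ℤ} (H : 5 ∣ g ^ 2 - g * h + h ^ 2) : 5 ∣ g ∧ 5 ∣ h := by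
  have key : ∀ u v : ZMod 5, u ^ 2 - u * v + v ^ 2 = 0 → u = 0 ∧ v = 0 := by decide
  have := key g h (by
    have := (ZMod.intCast_zmod_eq_zero_iff_dvd _ 5).2 H
    push_cast at this
    exact this)
  exact ⟨(ZMod.intCast_zmod_eq_zero_iff_dvd _ 5).1 this.1,
    (ZMod.intCast_zmod_eq_zero_iff_dvd _ 5).1 this.2⟩

/-- Splitting a product that is `125` times a cube, whose second factor is prime to `5`. -/
theorem exists_cubes_of_mul_eq {L N m : ℤ} (hN : ¬ 5 ∣ N) (heq : L * N = 125 * m ^ 3)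
    (H : ∀ p : ℤ, Prime p → p ∣ L → p ∣ N → p ∣ m → False) :
    ∃ k l : ℤ, L = 125 * k ^ 3 ∧ N = l ^ 3 ∧ m = k * l := by
  have h5 : Prime (5 : ℤ) := by norm_num
  obtain ⟨L', rfl⟩ : (125 : ℤ) ∣ L := by
    have := h5.pow_dvd_of_dvd_mul_right 3 hN (a := L) ⟨m ^ 3, by rw [heq]; ring⟩
    norm_num at this
    exact this
  have heq' : L' * N = m ^ 3 := by linarith
  have hN0 : N ≠ 0 := by rintro rfl; simp at hN
  have hcop : IsCoprime L' N := isCoprime_of_forall_prime (.inr hN0) fun p hp h1 h2 =>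
    H p hp (h1.mul_left _) h2 (hp.dvd_of_dvd_pow (heq' ▸ h1.mul_right N))
  obtain ⟨k, rfl⟩ := Int.eq_pow_of_mul_eq_pow_odd_left hcop (by decide) heq'
  obtain ⟨l, rfl⟩ := Int.eq_pow_of_mul_eq_pow_odd_right hcop (by decide) heq'
  exact ⟨k, l, rfl, rfl, cube_inj (by rw [← heq']; ring)⟩

section Descent

variable {a n m : ℤ}

theorem dvd_of_dvd_of_dvd_norm {p g h : ℤ} (hp : Prime p) (h1 : p ∣ g)
    (h2 : p ∣ g ^ 2 - g * h + h ^ 2) : p ∣ h := by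
  refine hp.dvd_of_dvd_pow (n := 2) ?_
  have : h ^ 2 = g ^ 2 - g * h + h ^ 2 - g * (g - h) := by ring
  rw [this]
  exact dvd_sub h2 (h1.mul_right _)

theorem not_dvd_left_of_dvd (han : IsCoprime a n)
    (heq : a ^ 3 - n ^ 3 - 7 * m ^ 3 = 4 * a * n * m) {p : ℤ} (hp : Prime p) (hm : p ∣ m) :
    ¬ p ∣ a := fun ha => hp.not_isUnit <| han.isUnit_of_dvd' ha <| hp.dvd_of_dvd_pow (n := 3) <| by
  have : n ^ 3 = a * (a ^ 2 - 4 * n * m) - m * (7 * m ^ 2) := by linear_combination -heq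
  rw [this]
  exact dvd_sub (ha.mul_right _) (hm.mul_right _)

theorem not_dvd_right_of_dvd (han : IsCoprime a n)
    (heq : a ^ 3 - n ^ 3 - 7 * m ^ 3 = 4 * a * n * m) {p : ℤ} (hp : Prime p) (hm : p ∣ m) :
    ¬ p ∣ n := fun hn =>
  not_dvd_left_of_dvd (a := -n) (n := -a) han.symm.neg_neg (by linear_combination heq) hp hm
    hn.neg_right

theorem five_not_dvd_norm (han : IsCoprime a n)
    (heq : a ^ 3 - n ^ 3 - 7 * m ^ 3 = 4 * a * n * m) :
    ¬ 5 ∣ (3 * a + 4 * m) ^ 2 - (3 * a + 4 * m) * (4 * m - 3 * n) + (4 * m - 3 * n) ^ 2 := by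
  intro H
  have h5 : Prime (5 : ℤ) := by norm_num
  have hprod : (3 * a - 3 * n - 4 * m) * ((3 * a + 4 * m) ^ 2 -
      (3 * a + 4 * m) * (4 * m - 3 * n) + (4 * m - 3 * n) ^ 2) = 125 * m ^ 3 := by
    linear_combination 27 * heq
  have hm : ¬ (5 : ℤ) ∣ m := fun hm => by
    obtain ⟨h1, -⟩ := five_dvd_of_dvd_norm H
    exact not_dvd_left_of_dvd han heq h5 hm (by omega)
  obtain ⟨⟨g, hg⟩, ⟨h, hh⟩⟩ := five_dvd_of_dvd_norm H
  rw [hg, hh] at hprod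
  have hL : ¬ (5 : ℤ) ∣ 3 * a - 3 * n - 4 * m := by omega
  have h1 : (3 * a - 3 * n - 4 * m) * (g ^ 2 - g * h + h ^ 2) = 5 * m ^ 3 := by linarith
  obtain ⟨⟨g, rfl⟩, ⟨h, rfl⟩⟩ := five_dvd_of_dvd_norm <|
    (h5.dvd_or_dvd (Dvd.intro _ h1.symm)).resolve_left hL
  refine hm (h5.dvd_of_dvd_pow (n := 3) ⟨(3 * a - 3 * n - 4 * m) * (g ^ 2 - g * h + h ^ 2), ?_⟩)
  linarith

/-- Descent along the isogeny with kernel `μ₃`. -/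
theorem exists_eisenstein_descent (han : IsCoprime a n)
    (heq : a ^ 3 - n ^ 3 - 7 * m ^ 3 = 4 * a * n * m) :
    ∃ e f k : ℤ, m = k * (e ^ 2 - e * f + f ^ 2) ∧
      3 * a + 4 * m = 3 * e ^ 2 * f - e ^ 3 - f ^ 3 ∧
      4 * m - 3 * n = 3 * e * f ^ 2 - e ^ 3 - f ^ 3 ∧
      3 * a - 3 * n - 4 * m = 125 * k ^ 3 := by
  have h5N := five_not_dvd_norm han heq
  have ha := fun p hp => not_dvd_left_of_dvd (p := p) han heq hp
  have hn := fun p hp => not_dvd_right_of_dvd (p := p) han heq hp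
  have dvd_sq {p u v : ℤ} (hp : Prime p) (h : p ∣ u ^ 2 - u * v + v ^ 2) (h1 : p ∣ v) : p ∣ u :=
    dvd_of_dvd_of_dvd_norm hp h1 (by convert h using 1; ring)
  have norm_cube (e f : ℤ) : (e ^ 2 - e * f + f ^ 2) ^ 3 =
      (e ^ 3 + f ^ 3 - 3 * e * f ^ 2) ^ 2 - (e ^ 3 + f ^ 3 - 3 * e * f ^ 2) *
      (3 * e ^ 2 * f - 3 * e * f ^ 2) + (3 * e ^ 2 * f - 3 * e * f ^ 2) ^ 2 := by ring
  by_cases h3 : (3 : ℤ) ∣ m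
  · obtain ⟨m', rfl⟩ := h3
    have ha3 := ha 3 Int.prime_three ⟨m', rfl⟩
    have hn3 := hn 3 Int.prime_three ⟨m', rfl⟩
    obtain ⟨t, ht⟩ : (3 : ℤ) ∣ a - n := by
      have h1 : (3 : ℤ) ∣ (a - n) ^ 3 :=
        ⟨63 * m' ^ 3 + 4 * a * n * m' - a * n * (a - n), by linear_combination heq⟩
      exact Int.prime_three.dvd_of_dvd_pow h1
    obtain rfl : a = n + 3 * t := by linarith
    obtain ⟨m, rfl⟩ : (3 : ℤ) ∣ m' := by
      have h1 : (3 : ℤ) ∣ m' * ((n + 3 * t) * n) :=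
        ⟨t * n ^ 2 + 3 * t ^ 2 * n + 3 * t ^ 3 - 21 * m' ^ 3 - (n + 3 * t) * n * m', by
          linarith⟩
      rcases Int.prime_three.dvd_or_dvd h1 with h | h
      · exact h
      · rcases Int.prime_three.dvd_or_dvd h with h | h <;> tauto
    obtain ⟨w, hw⟩ : (3 : ℤ) ∣ t - m := by
      have h1 : (3 : ℤ) ∣ (t - m) * n ^ 2 :=
        ⟨m * n ^ 2 + 4 * t * m * n - t ^ 2 * n - t ^ 3 + 189 * m ^ 3, by linarith⟩
      rcases Int.prime_three.dvd_or_dvd h1 with h | h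
      · exact h
      · exact (hn3 (Int.prime_three.dvd_of_dvd_pow h)).elim
    obtain rfl : t = m + 3 * w := by linarith
    obtain ⟨p, hp⟩ : ∃ p, p = n + 6 * m + 6 * w := ⟨_, rfl⟩
    obtain ⟨q, hq⟩ : ∃ q, q = 9 * m + 3 * w := ⟨_, rfl⟩
    have hN5 : ¬ 5 ∣ p ^ 2 - p * q + q ^ 2 := fun h => h5N <| by
      rw [show (3 * (n + 3 * (m + 3 * w)) + 4 * (3 * (3 * m))) ^ 2 -
        (3 * (n + 3 * (m + 3 * w)) + 4 * (3 * (3 * m))) * (4 * (3 * (3 * m)) - 3 * n) +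
        (4 * (3 * (3 * m)) - 3 * n) ^ 2 = 27 * (p ^ 2 - p * q + q ^ 2) by subst hp hq; ring]
      exact h.mul_left _
    have hn' : ∀ r : ℤ, Prime r → r ∣ m → ¬ r ∣ n := fun r hr h =>
      hn r hr ((h.mul_left _).mul_left _)
    obtain ⟨k, l, hk, hl, hkl⟩ := exists_cubes_of_mul_eq (L := w - m) (m := m) hN5
      (by subst hp hq; linarith) fun r hr h1 h2 h3 => by
        have hrw : r ∣ w := by simpa using dvd_add h1 h3
        have hrq : r ∣ q := hq ▸ dvd_add (h3.mul_left _) (hrw.mul_left _)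
        have hrp := dvd_sq hr h2 hrq
        refine hn' r hr h3 ?_
        rw [show n = p - 6 * m - 6 * w by rw [hp]; ring]
        exact dvd_sub (dvd_sub hrp (h3.mul_left _)) (hrw.mul_left _)
    have hp3 : ¬ 3 ∣ p := by omega
    have hq3 : 3 ∣ q := by omega
    have hpq : IsCoprime p q := isCoprime_of_forall_prime (.inl (by rintro rfl; simp at hp3))
      fun r hr h1 h2 => by
        have hrl : r ∣ l := hr.dvd_of_dvd_pow (n := 3) <| hl ▸
          dvd_add (dvd_sub (dvd_pow h1 two_ne_zero) (h1.mul_right _)) (dvd_pow h2 two_ne_zero)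
        have hrm : r ∣ m := hkl ▸ hrl.mul_left k
        refine hn' r hr hrm ?_
        rw [show n = p - 2 * q + 12 * m by rw [hp, hq]; ring]
        exact dvd_add (dvd_sub h1 (h2.mul_left _)) (hrm.mul_left _)
    have hl3 : ¬ 3 ∣ l := fun h => hp3 <|
      dvd_sq Int.prime_three (hl ▸ dvd_pow h three_ne_zero) hq3
    obtain ⟨e, f, c, d, hc, hd, H⟩ := exists_eisenstein_cube hpq hl3 hl
    have hd3 : 3 ∣ d := ⟨e ^ 2 * f - e * f ^ 2, by rw [hd]; ring⟩
    obtain ⟨rfl, rfl⟩ : p = c ∧ q = d := by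
      rcases H with H | H | H
      · exact H
      · omega
      · omega
    have hle : l = e ^ 2 - e * f + f ^ 2 := cube_inj (by rw [← hl, norm_cube, hc, hd])
    have e1 : n + 6 * m + 6 * w = e ^ 3 + f ^ 3 - 3 * e * f ^ 2 := by rw [← hc, hp]
    have e2 : 9 * m + 3 * w = 3 * e ^ 2 * f - 3 * e * f ^ 2 := by rw [← hd, hq]
    refine ⟨-(e + f), e - 2 * f, 3 * k, ?_, ?_, ?_, ?_⟩
    · rw [hkl, hle]; ring
    · linear_combination 3 * e1 + 3 * e2
    · linear_combination -3 * e1 + 6 * e2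
    · linear_combination 27 * hk
  · obtain ⟨g, hg⟩ : ∃ g, g = 3 * a + 4 * m := ⟨_, rfl⟩
    obtain ⟨h, hh⟩ : ∃ h, h = 4 * m - 3 * n := ⟨_, rfl⟩
    rw [← hg, ← hh] at h5N
    have not3 (r : ℤ) (hr : Prime r) (hrm : r ∣ m) : ¬ r ∣ 3 := fun h =>
      h3 <| ((hr.dvd_prime_iff_associated Int.prime_three).1 h).symm.dvd.trans hrm
    have hg' (r : ℤ) (hr : Prime r) (hrm : r ∣ m) : ¬ r ∣ g := fun h => by
      have : r ∣ 3 * a := by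
        rw [show 3 * a = g - 4 * m by rw [hg]; ring]
        exact dvd_sub h (hrm.mul_left _)
      rcases hr.dvd_or_dvd this with h | h
      · exact not3 r hr hrm h
      · exact ha r hr hrm h
    obtain ⟨k, l, hk, hl, hkl⟩ := exists_cubes_of_mul_eq (L := 3 * a - 3 * n - 4 * m) (m := m) h5N
      (by subst hg hh; linear_combination 27 * heq) fun r hr h1 h2 h3 => by
        have hgh : r ∣ g + h := by
          rw [show g + h = 3 * a - 3 * n - 4 * m + 12 * m by rw [hg, hh]; ring]
          exact dvd_add h1 (h3.mul_left _)
        have h4 : r ∣ 3 * g ^ 2 := by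
          rw [show 3 * g ^ 2 = g ^ 2 - g * h + h ^ 2 + (g + h) * (2 * g - h) by ring]
          exact dvd_add h2 (hgh.mul_right _)
        rcases hr.dvd_or_dvd h4 with h | h
        · exact not3 r hr h3 h
        · exact hg' r hr h3 (hr.dvd_of_dvd_pow h)
    have hcop : IsCoprime g h := isCoprime_of_forall_prime (.inl (by omega))
      fun r hr h1 h2 => by
        have hrl : r ∣ l := hr.dvd_of_dvd_pow (n := 3) <| hl ▸
          dvd_add (dvd_sub (dvd_pow h1 two_ne_zero) (h1.mul_right _)) (dvd_pow h2 two_ne_zero)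
        exact hg' r hr (hkl ▸ hrl.mul_left k) h1
    have hl3 : ¬ 3 ∣ l := fun h => h3 (hkl ▸ h.mul_left k)
    obtain ⟨e, f, c, d, hc, hd, H⟩ := exists_eisenstein_cube hcop hl3 hl
    have hd3 : 3 ∣ d := ⟨e ^ 2 * f - e * f ^ 2, by rw [hd]; ring⟩
    obtain ⟨hgd, hhc⟩ : g = d - c ∧ h = -c := by
      rcases H with H | H | H
      · omega
      · omega
      · exact H
    have hle : l = e ^ 2 - e * f + f ^ 2 := cube_inj (by
      rw [← hl, norm_cube, ← hc, ← hd, hgd, hhc]; ring)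
    refine ⟨e, f, k, by rw [hkl, hle], ?_, ?_, hk⟩
    · rw [← hg, hgd, hc, hd]; ring
    · rw [← hh, hhc, hc]; ring

theorem exists_cubes_of_mul_eq_seven {u v w k : ℤ} (huv : IsCoprime u v) (huw : IsCoprime u w)
    (hvw : IsCoprime v w) (hprod : u * v * w = 7 * k ^ 3) (hsum : u + v + w = 4 * k)
    (hu : 7 ∣ u) :
    ∃ x y z : ℤ, k = x * y * z ∧ IsCoprime y z ∧ 7 * x ^ 3 + y ^ 3 + z ^ 3 = 4 * (x * y * z) := by
  obtain ⟨u, rfl⟩ := hu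
  have h1 : u * (v * w) = k ^ 3 := by linarith
  have hcop : IsCoprime u (v * w) :=
    (huv.of_isCoprime_of_dvd_left (Dvd.intro_left _ rfl)).mul_right
      (huw.of_isCoprime_of_dvd_left (Dvd.intro_left _ rfl))
  obtain ⟨x, rfl⟩ := Int.eq_pow_of_mul_eq_pow_odd_left hcop (by decide) h1
  obtain ⟨s, hs⟩ := Int.eq_pow_of_mul_eq_pow_odd_right hcop (by decide) h1
  obtain ⟨y, rfl⟩ := Int.eq_pow_of_mul_eq_pow_odd_left hvw (by decide) hs
  obtain ⟨z, rfl⟩ := Int.eq_pow_of_mul_eq_pow_odd_right hvw (by decide) hs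
  have hk : k = x * y * z := cube_inj (by rw [← h1]; ring)
  exact ⟨x, y, z, hk, (IsCoprime.pow_iff three_pos three_pos).1 hvw, by rw [hsum, hk]⟩

/-- Multiplication by three can be undone on nontrivial points. -/
theorem exists_smaller (han : IsCoprime a n) (hm : m ≠ 0)
    (heq : a ^ 3 - n ^ 3 - 7 * m ^ 3 = 4 * a * n * m) :
    ∃ x y z t : ℤ, m = x * (y * z * t) ∧ IsCoprime y z ∧
      7 * x ^ 3 + y ^ 3 + z ^ 3 = 4 * (x * y * z) := by
  obtain ⟨e, f, k, hmk, h1, h2, h3⟩ := exists_eisenstein_descent han heq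
  have hrst : (e + f) * (f - 2 * e) * (e - 2 * f) =
      125 * k ^ 3 + 12 * k * (e ^ 2 - e * f + f ^ 2) := by
    linear_combination h3 - h1 - h2 + 12 * hmk
  obtain ⟨u, hu⟩ : (3 : ℤ) ∣ e + f + 4 * k := by
    refine Int.prime_three.dvd_of_dvd_pow (n := 3) ?_
    exact ⟨63 * k ^ 3 + 4 * k * (e ^ 2 - e * f + f ^ 2) + (e + f) ^ 3 - 3 * (e + f) * e * f +
      4 * (e + f) ^ 2 * k + 16 * (e + f) * k ^ 2, by linear_combination hrst⟩
  obtain ⟨v, hv⟩ : ∃ v, v = u - e := ⟨_, rfl⟩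
  obtain ⟨w, hw⟩ : ∃ w, w = u - f := ⟨_, rfl⟩
  have hsum : u + v + w = 4 * k := by linarith
  have hprod : u * v * w = 7 * k ^ 3 := by
    have : 27 * (u * v * w) = 27 * (7 * k ^ 3) := by
      obtain rfl : f = 3 * u - e - 4 * k := by linarith
      subst hv hw
      linear_combination hrst
    linarith
  have hk0 : k ≠ 0 := by rintro rfl; simp at hmk; exact hm hmk
  have hcommon (p : ℤ) (hp : Prime p) (hpk : p ∣ k) (hpu : p ∣ u) (hpv : p ∣ v) : False := by
    have hpw : p ∣ w := by
      rw [show w = 4 * k - u - v by linarith]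
      exact dvd_sub (dvd_sub (hpk.mul_left _) hpu) hpv
    obtain ⟨k', rfl⟩ := hpk
    obtain ⟨e', rfl⟩ : p ∣ e := by rw [show e = u - v by linarith]; exact dvd_sub hpu hpv
    obtain ⟨f', rfl⟩ : p ∣ f := by rw [show f = u - w by linarith]; exact dvd_sub hpu hpw
    have key (b : ℤ) (h : p ^ 3 ∣ 3 * b) : p ∣ b := by
      by_contra hb
      have h4 := hp.pow_dvd_of_dvd_mul_right 3 hb h
      exact hp.not_isUnit <| Int.prime_three.irreducible.squarefree p <|
        (Dvd.intro p (by ring)).trans h4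
    refine hp.not_isUnit (han.isUnit_of_dvd' (key a ⟨3 * e' ^ 2 * f' - e' ^ 3 - f' ^ 3 -
      4 * k' * (e' ^ 2 - e' * f' + f' ^ 2), ?_⟩) (key n ⟨4 * k' * (e' ^ 2 - e' * f' + f' ^ 2) -
      (3 * e' * f' ^ 2 - e' ^ 3 - f' ^ 3), ?_⟩))
    · linear_combination h1 - 4 * hmk
    · linear_combination 4 * hmk - h2
  have hpk (p : ℤ) (hp : Prime p) (x y : ℤ) (hx : p ∣ x) (hy : p ∣ y) (z : ℤ)
      (h : x * y * z = 7 * k ^ 3) : p ∣ k := by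
    by_contra hk
    have hd : p ^ 2 ∣ 7 * k ^ 3 := by
      rw [← h, sq]; exact (mul_dvd_mul hx hy).mul_right z
    have h7 := hp.pow_dvd_of_dvd_mul_right 2 (fun h => hk (hp.dvd_of_dvd_pow h)) hd
    have : Prime (7 : ℤ) := by norm_num
    exact hp.not_isUnit <| this.irreducible.squarefree p (by rwa [← sq])
  have hne : u ≠ 0 ∧ v ≠ 0 ∧ w ≠ 0 := by
    have : u * v * w ≠ 0 := by rw [hprod]; positivity
    simpa [and_assoc] using this
  have huv : IsCoprime u v := isCoprime_of_forall_prime (.inl hne.1) fun p hp hu hv =>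
    hcommon p hp (hpk p hp u v hu hv w hprod) hu hv
  have huw : IsCoprime u w := isCoprime_of_forall_prime (.inl hne.1) fun p hp hu hw => by
    have hk := hpk p hp u w hu hw v (by linarith)
    refine hcommon p hp hk hu ?_
    rw [show v = 4 * k - u - w by linarith]
    exact dvd_sub (dvd_sub (hk.mul_left _) hu) hw
  have hvw : IsCoprime v w := isCoprime_of_forall_prime (.inl hne.2.1) fun p hp hv hw => by
    have hk := hpk p hp v w hv hw u (by linarith)
    refine hcommon p hp hk ?_ hv
    rw [show u = 4 * k - v - w by linarith]
    exact dvd_sub (dvd_sub (hk.mul_left _) hv) hw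
  obtain ⟨x, y, z, hk, hyz, h⟩ : ∃ x y z : ℤ, k = x * y * z ∧ IsCoprime y z ∧
      7 * x ^ 3 + y ^ 3 + z ^ 3 = 4 * (x * y * z) := by
    have h7 : Prime (7 : ℤ) := by norm_num
    rcases h7.dvd_or_dvd (Dvd.intro _ hprod.symm) with h | h
    · rcases h7.dvd_or_dvd h with h | h
      · exact exists_cubes_of_mul_eq_seven huv huw hvw hprod hsum h
      · exact exists_cubes_of_mul_eq_seven huv.symm hvw huw (by linarith) (by linarith) h
    · exact exists_cubes_of_mul_eq_seven huw.symm hvw.symm huv (by linarith) (by linarith) h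
  exact ⟨x, y, z, e ^ 2 - e * f + f ^ 2, by rw [hmk, hk]; ring, hyz, h⟩

theorem eq_zero_of_cubic (han : IsCoprime a n)
    (heq : a ^ 3 - n ^ 3 - 7 * m ^ 3 = 4 * a * n * m) : m = 0 := by
  induction hM : m.natAbs using Nat.strong_induction_on generalizing a n m with
  | _ M ih =>
  by_contra hm
  obtain ⟨x, y, z, t, hmx, hyz, h⟩ := exists_smaller han hm heq
  have hx0 : x ≠ 0 := by rintro rfl; simp at hmx; exact hm hmx
  by_cases hlt : x.natAbs < M
  · have := ih _ hlt hyz.neg_right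
      (show y ^ 3 - (-z) ^ 3 - 7 * (-x) ^ 3 = 4 * y * (-z) * (-x) by linear_combination h) (by simp)
    omega
  · have hs : (y * z * t).natAbs = 1 := by
      have h0 : y * z * t ≠ 0 := by intro h0; rw [h0] at hmx; simp at hmx; exact hm hmx
      rw [← hM, hmx, Int.natAbs_mul] at hlt
      have := Int.natAbs_pos.2 hx0
      have := Int.natAbs_pos.2 h0
      nlinarith
    have hu := isUnit_of_mul_isUnit_left (Int.isUnit_iff_natAbs_eq.2 hs)
    have hbound (s : ℤ) (hs : x * (7 * x ^ 2 - 4) = s) (hs2 : s = 2 ∨ s = -2) : False := by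
      have : x ∣ 2 := by
        rcases hs2 with rfl | rfl
        · exact Dvd.intro _ hs
        · exact (dvd_neg.1 (Dvd.intro _ hs))
      have h1 := Int.le_of_dvd two_pos this
      have h2 := Int.le_of_dvd two_pos (neg_dvd.2 this)
      obtain ⟨h3, h4⟩ : -2 ≤ x ∧ x ≤ 2 := by omega
      interval_cases x <;> omega
    rcases Int.isUnit_iff.1 (isUnit_of_mul_isUnit_left hu) with rfl | rfl <;>
    rcases Int.isUnit_iff.1 (isUnit_of_mul_isUnit_right hu) with rfl | rfl
    · exact hbound (-2) (by linarith) (.inr rfl)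
    · have : x * (7 * x ^ 2 + 4) = 0 := by linarith
      rcases mul_eq_zero.1 this with h | h
      · exact hx0 h
      · nlinarith
    · have : x * (7 * x ^ 2 + 4) = 0 := by linarith
      rcases mul_eq_zero.1 this with h | h
      · exact hx0 h
      · nlinarith
    · exact hbound 2 (by linarith) (.inl rfl)

end Descent

theorem seven_dvd_of_dvd_quadratic {X Y : ℤ} (H : 7 ∣ X ^ 2 + X * Y - Y ^ 2) : 7 ∣ X ∧ 7 ∣ Y := by
  have key : ∀ u v : ZMod 7, u ^ 2 + u * v - v ^ 2 = 0 → u = 0 ∧ v = 0 := by decide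
  have := key X Y (by
    have := (ZMod.intCast_zmod_eq_zero_iff_dvd _ 7).2 H
    push_cast at this
    exact this)
  exact ⟨(ZMod.intCast_zmod_eq_zero_iff_dvd _ 7).1 this.1,
    (ZMod.intCast_zmod_eq_zero_iff_dvd _ 7).1 this.2⟩

theorem two_dvd_of_dvd_quadratic {X Y : ℤ} (H : 2 ∣ X ^ 2 + X * Y - Y ^ 2) : 2 ∣ X ∧ 2 ∣ Y := by
  have key : ∀ u v : ZMod 2, u ^ 2 + u * v - v ^ 2 = 0 → u = 0 ∧ v = 0 := by decide
  have := key X Y (by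
    have := (ZMod.intCast_zmod_eq_zero_iff_dvd _ 2).2 H
    push_cast at this
    exact this)
  exact ⟨(ZMod.intCast_zmod_eq_zero_iff_dvd _ 2).1 this.1,
    (ZMod.intCast_zmod_eq_zero_iff_dvd _ 2).1 this.2⟩

/-- A point of the genus one quotient with square `s`-coordinate numerator lies over a cusp. -/
theorem eq_zero_of_quartic {a b T : ℤ} (haT : IsCoprime a T)
    (heq : b ^ 2 = a ^ 2 * (a ^ 2 - 4 * T) ^ 2 - 28 * T ^ 3) : T = 0 := by
  obtain ⟨W, hW⟩ : ∃ W, W = a * (a ^ 2 - 4 * T) := ⟨_, rfl⟩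
  have hprod : (W - b) * (W + b) = 28 * T ^ 3 := by rw [hW]; linear_combination -heq
  obtain ⟨P, hP⟩ : (2 : ℤ) ∣ W - b := by
    have h1 : (2 : ℤ) ∣ (W - b) * (W + b) := ⟨14 * T ^ 3, by rw [hprod]; ring⟩
    rcases Int.prime_two.dvd_or_dvd h1 with h | h <;> omega
  obtain ⟨Q, hQ⟩ : ∃ Q, Q = P + b := ⟨_, rfl⟩
  have hPQ : P * Q = 7 * T ^ 3 := by
    have : W + b = 2 * Q := by linarith
    rw [hP, this] at hprod
    linarith
  have hsum : P + Q = W := by linarith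
  by_contra hT
  have hne : P ≠ 0 := by
    rintro rfl
    rw [zero_mul] at hPQ
    exact (by positivity : 7 * T ^ 3 ≠ 0) hPQ.symm
  have h7 : Prime (7 : ℤ) := by norm_num
  have hcop : IsCoprime P Q := isCoprime_of_forall_prime (.inl hne) fun p hp h1 h2 => by
    have hpT : p ∣ T := by
      by_contra hk
      have hd : p ^ 2 ∣ 7 * T ^ 3 := by
        rw [← hPQ, sq]; exact mul_dvd_mul h1 h2
      have hd7 := hp.pow_dvd_of_dvd_mul_right 2 (fun h => hk (hp.dvd_of_dvd_pow h)) hd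
      exact hp.not_isUnit <| h7.irreducible.squarefree p (by rwa [← sq])
    have hpa : p ∣ a ^ 3 := by
      rw [show a ^ 3 = P + Q + T * (4 * a) by rw [hsum, hW]; ring]
      exact dvd_add (dvd_add h1 h2) (hpT.mul_right _)
    exact hp.not_isUnit (haT.isUnit_of_dvd' (hp.dvd_of_dvd_pow hpa) hpT)
  have main {P Q : ℤ} (hcop : IsCoprime P Q) (hPQ : P * Q = 7 * T ^ 3) (hsum : P + Q = W)
      (hP : 7 ∣ P) : T = 0 := by
    obtain ⟨P, rfl⟩ := hP
    have h1 : P * Q = T ^ 3 := by linarith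
    have h2 : IsCoprime P Q := hcop.of_isCoprime_of_dvd_left (Dvd.intro_left _ rfl)
    obtain ⟨m, rfl⟩ := Int.eq_pow_of_mul_eq_pow_odd_left h2 (by decide) h1
    obtain ⟨n, rfl⟩ := Int.eq_pow_of_mul_eq_pow_odd_right h2 (by decide) h1
    obtain rfl : T = m * n := cube_inj (by rw [← h1]; ring)
    rw [eq_zero_of_cubic (haT.of_isCoprime_of_dvd_right (Dvd.intro_left m rfl))
      (m := m) (by linear_combination -hsum - hW), zero_mul]
  rcases h7.dvd_or_dvd (Dvd.intro _ hPQ.symm) with h | h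
  · exact hT (main hcop hPQ hsum h)
  · exact hT (main hcop.symm (by linarith) (by linarith) h)

theorem X0_35_integral_points {X Y Z : ℤ} (hXY : IsCoprime X Y)
    (heq : Z ^ 2 = (X ^ 2 + X * Y - Y ^ 2) *
      (X ^ 6 - 5 * X ^ 5 * Y - 9 * X ^ 3 * Y ^ 3 - 5 * X * Y ^ 5 - Y ^ 6)) : X * Y = 0 := by
  obtain ⟨S, hS⟩ : ∃ S, S = X ^ 2 + X * Y - Y ^ 2 := ⟨_, rfl⟩
  obtain ⟨T, hT⟩ : ∃ T, T = X * Y := ⟨_, rfl⟩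
  obtain ⟨D, hD⟩ : ∃ D, D = S ^ 3 - 8 * S ^ 2 * T + 16 * S * T ^ 2 - 28 * T ^ 3 := ⟨_, rfl⟩
  have hZ : S * D = Z ^ 2 := by rw [heq, hD, hS, hT]; ring
  have h2S : ¬ 2 ∣ S := fun h => by
    obtain ⟨h1, h2⟩ := two_dvd_of_dvd_quadratic (hS ▸ h)
    exact Int.prime_two.not_isUnit (hXY.isUnit_of_dvd' h1 h2)
  have h7 : Prime (7 : ℤ) := by norm_num
  have h7S : ¬ 7 ∣ S := fun h => by
    obtain ⟨h1, h2⟩ := seven_dvd_of_dvd_quadratic (hS ▸ h)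
    exact h7.not_isUnit (hXY.isUnit_of_dvd' h1 h2)
  have hST : IsCoprime S T := by
    rw [hS, hT]
    refine IsCoprime.mul_right ?_ ?_
    · rw [show X ^ 2 + X * Y - Y ^ 2 = -Y ^ 2 + X * (X + Y) by ring]
      exact (hXY.symm.pow_left (m := 2)).neg_left.add_mul_left_left _
    · rw [show X ^ 2 + X * Y - Y ^ 2 = X ^ 2 + Y * (X - Y) by ring]
      exact (hXY.pow_left (m := 2)).add_mul_left_left _
  have hSD : IsCoprime S D := by
    rw [show D = -(2 * 2 * 7 * T ^ 3) + S * (S ^ 2 - 8 * S * T + 16 * T ^ 2) by rw [hD]; ring]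
    have c2 := ((Int.prime_two.coprime_iff_not_dvd).2 h2S).symm
    have c7 := ((h7.coprime_iff_not_dvd).2 h7S).symm
    exact (((c2.mul_right c2).mul_right c7).mul_right hST.pow_right).neg_right.add_mul_left_right _
  obtain ⟨a, ha⟩ := Int.sq_of_isCoprime hSD hZ
  have ha0 : a ≠ 0 := by
    rintro rfl
    exact h2S (by simp_all)
  obtain ⟨b, rfl⟩ : a ∣ Z := by
    rw [← Int.pow_dvd_pow_iff two_ne_zero, ← hZ]
    rcases ha with ha | ha <;> rw [ha]
    · exact Dvd.intro _ rfl
    · exact (dvd_neg.2 dvd_rfl).mul_right _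
  rw [← hT]
  have ha2 : a ^ 2 ≠ 0 := pow_ne_zero 2 ha0
  rcases ha with rfl | rfl
  · refine eq_zero_of_quartic (a := a) (b := b) ((IsCoprime.pow_left_iff two_pos).1 hST) ?_
    apply mul_left_cancel₀ ha2
    linear_combination a ^ 2 * hD - hZ
  · have := eq_zero_of_quartic (a := a) (b := b) (T := -T)
      ((IsCoprime.pow_left_iff two_pos).1 (by simpa using hST.neg_neg)) (by
        apply mul_left_cancel₀ ha2
        linear_combination -a ^ 2 * hD - hZ)
    simpa using this

/-- The only affine rational points on Galbraith's model
`y² = (x² + x − 1)(x⁶ − 5x⁵ − 9x³ − 5x − 1)` of `X₀(35)` are the two finite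
cusps `(0, ±1)`. -/
theorem X0_35_rational_points (x y : ℚ)
    (hxy : y ^ 2 = (x ^ 2 + x - 1) * (x ^ 6 - 5 * x ^ 5 - 9 * x ^ 3 - 5 * x - 1)) :
    x = 0 ∧ (y = 1 ∨ y = -1) := by
  have hx : x = 0 := by
    have hden : (x.den : ℚ) ≠ 0 := by exact_mod_cast x.den_nz
    have hnum : (x.num : ℚ) = x * x.den := (Rat.mul_den_eq_num x).symm
    have hsq : (y * x.den ^ 4) ^ 2 =
        (((x.num ^ 2 + x.num * x.den - x.den ^ 2) * (x.num ^ 6 - 5 * x.num ^ 5 * x.den -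
          9 * x.num ^ 3 * x.den ^ 3 - 5 * x.num * x.den ^ 5 - x.den ^ 6) : ℤ) : ℚ) := by
      push_cast
      rw [hnum, mul_pow, hxy]
      ring
    have hint : (y * x.den ^ 4).den = 1 := by
      have := congrArg Rat.den hsq
      rw [Rat.den_pow, Rat.den_intCast] at this
      exact Nat.eq_one_of_mul_eq_one_right (by rwa [sq] at this)
    rw [← (Rat.den_eq_one_iff _).1 hint] at hsq
    have h0 := X0_35_integral_points (Rat.isCoprime_num_den x) (by exact_mod_cast hsq)
    rcases mul_eq_zero.1 h0 with h | h
    · exact Rat.num_eq_zero.1 h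
    · exact absurd h (by exact_mod_cast x.den_nz)
  refine ⟨hx, sq_eq_one_iff.1 ?_⟩
  rw [hxy, hx]
  norm_num
end

section
/- Let F(u,v,w) be the sextic 5u⁶ − 50u⁵v + 206u⁴v² − 408u³v³ + 321u²v⁴ + 10uv⁵ − 100v⁶ + 9u⁴w² − 60u³vw² + 80u²v²w² + 48uv³w² + 15v⁴w² + 3u²w⁴ − 10uvw⁴ + 6v²w⁴ − w⁶ over ℂ. A point (u, v, w) ∈ ℂ³ \ {0} satisfies ∂F/∂u = ∂F/∂v = ∂F/∂w = 0 (and hence F = 0) if and only if (u : v : w) is, up to a nonzero scalar, one of the four points p₁ = (i : 0 : 1), p₂ = (−i : 0 : 1), p₃ = (0 : 1/√5 : 1), p₄ = (0 : −1/√5 : 1). That is, the singular locus of the plane sextic D consists exactly of these four points. -/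
open MvPolynomial

/-- The homogeneous sextic defining the plane model `D` of `X(b5,ns7)`,
as a polynomial in the variables `u = X 0`, `v = X 1`, `w = X 2` over `ℂ`. -/
noncomputable def sexticD : MvPolynomial (Fin 3) ℂ :=
  5 * X 0 ^ 6 - 50 * X 0 ^ 5 * X 1 + 206 * X 0 ^ 4 * X 1 ^ 2 - 408 * X 0 ^ 3 * X 1 ^ 3
    + 321 * X 0 ^ 2 * X 1 ^ 4 + 10 * X 0 * X 1 ^ 5 - 100 * X 1 ^ 6
    + 9 * X 0 ^ 4 * X 2 ^ 2 - 60 * X 0 ^ 3 * X 1 * X 2 ^ 2 + 80 * X 0 ^ 2 * X 1 ^ 2 * X 2 ^ 2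
    + 48 * X 0 * X 1 ^ 3 * X 2 ^ 2 + 15 * X 1 ^ 4 * X 2 ^ 2
    + 3 * X 0 ^ 2 * X 2 ^ 4 - 10 * X 0 * X 1 * X 2 ^ 4 + 6 * X 1 ^ 2 * X 2 ^ 4 - X 2 ^ 6

/-- The three partial derivatives of the sextic vanish at `(u, v, w)`. -/
def SexticGradientVanishes (u v w : ℂ) : Prop :=
  30 * u ^ 5 - 250 * u ^ 4 * v + 824 * u ^ 3 * v ^ 2 - 1224 * u ^ 2 * v ^ 3 + 642 * u * v ^ 4
      + 10 * v ^ 5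
      + 36 * u ^ 3 * w ^ 2 - 180 * u ^ 2 * v * w ^ 2 + 160 * u * v ^ 2 * w ^ 2
      + 48 * v ^ 3 * w ^ 2 + 6 * u * w ^ 4 - 10 * v * w ^ 4 = 0 ∧
  -50 * u ^ 5 + 412 * u ^ 4 * v - 1224 * u ^ 3 * v ^ 2 + 1284 * u ^ 2 * v ^ 3 + 50 * u * v ^ 4
      - 600 * v ^ 5
      - 60 * u ^ 3 * w ^ 2 + 160 * u ^ 2 * v * w ^ 2 + 144 * u * v ^ 2 * w ^ 2
      + 60 * v ^ 3 * w ^ 2 - 10 * u * w ^ 4 + 12 * v * w ^ 4 = 0 ∧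
  2 * w * (9 * u ^ 4 - 60 * u ^ 3 * v + 80 * u ^ 2 * v ^ 2 + 48 * u * v ^ 3 + 15 * v ^ 4
      + 6 * u ^ 2 * w ^ 2 - 20 * u * v * w ^ 2 + 12 * v ^ 2 * w ^ 2 - 3 * w ^ 4) = 0

theorem forall_eval_pderiv_sexticD_eq_zero_iff (x : Fin 3 → ℂ) :
    (∀ i : Fin 3, eval x (pderiv i sexticD) = 0) ↔
      SexticGradientVanishes (x 0) (x 1) (x 2) := by
  have h10 : (1 : Fin 3) ≠ 0 := by decide
  have h20 : (2 : Fin 3) ≠ 0 := by decide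
  have h21 : (2 : Fin 3) ≠ 1 := by decide
  have hC (n : ℕ) [n.AtLeastTwo] (i : Fin 3) :
      pderiv i (OfNat.ofNat n : MvPolynomial (Fin 3) ℂ) = 0 :=
    pderiv_C (R := ℂ) (a := (OfNat.ofNat n : ℂ))
  simp only [SexticGradientVanishes, Fin.forall_fin_succ, Fin.forall_fin_zero]
  simp [sexticD, Derivation.leibniz, Derivation.leibniz_pow, pderiv_X, hC, h10, h20, h21,
    h10.symm, h20.symm, h21.symm, -mul_eq_zero]
  refine and_congr ?_ (and_congr ?_ ?_) <;> refine Eq.congr_left ?_ <;> ring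

theorem u_eq_zero_and_v_eq_zero_of_binary_sextic {u v : ℂ}
    (h1 : 30 * u ^ 5 - 250 * u ^ 4 * v + 824 * u ^ 3 * v ^ 2 - 1224 * u ^ 2 * v ^ 3 + 642 * u * v ^ 4
      + 10 * v ^ 5 = 0)
    (h2 : -50 * u ^ 5 + 412 * u ^ 4 * v - 1224 * u ^ 3 * v ^ 2 + 1284 * u ^ 2 * v ^ 3 + 50 * u * v ^ 4
      - 600 * v ^ 5 = 0) :
    u = 0 ∧ v = 0 := by
  have hu : u ^ 9 = 0 := by
    linear_combination
      (171755 / 10976 * v ^ 4 + 449065 / 131712 * u * v ^ 3 - 7143039 / 219520 * u ^ 2 * v ^ 2 +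
        4851521 / 219520 * u ^ 3 * v - 369589 / 94080 * u ^ 4) * h1 + (34351 / 131712 * v ^ 4 +
        1846401 / 109760 * u * v ^ 3 - 589557 / 21952 * u ^ 2 * v ^ 2 + 4384543 / 329280 * u ^ 3 *
        v - 14909 / 6272 * u ^ 4) * h2
  have hv : v ^ 9 = 0 := by
    linear_combination
      (-9393 / 274400 * v ^ 4 - 387239 / 16464000 * u * v ^ 3 + 884719 / 16464000 * u ^ 2 * v ^ 2
        - 374617 / 16464000 * u ^ 3 * v + 2057 / 658560 * u ^ 4) * h1 + (-36833 / 16464000 * v ^ 4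
        - 306277 / 8232000 * u * v ^ 3 + 310117 / 8232000 * u ^ 2 * v ^ 2 - 4553 / 329280 * u ^ 3
        * v + 2057 / 1097600 * u ^ 4) * h2
  exact ⟨pow_eq_zero_iff (by norm_num) |>.1 hu, pow_eq_zero_iff (by norm_num) |>.1 hv⟩

theorem mul_eq_zero_of_sextic_gradient {u v w : ℂ} (hw : w ≠ 0)
    (h0 : 9 * u ^ 4 - 60 * u ^ 3 * v + 80 * u ^ 2 * v ^ 2 + 48 * u * v ^ 3 + 15 * v ^ 4
      + 6 * u ^ 2 * w ^ 2 - 20 * u * v * w ^ 2 + 12 * v ^ 2 * w ^ 2 - 3 * w ^ 4 = 0)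
    (h1 : 30 * u ^ 5 - 250 * u ^ 4 * v + 824 * u ^ 3 * v ^ 2 - 1224 * u ^ 2 * v ^ 3 + 642 * u * v ^ 4
      + 10 * v ^ 5
      + 36 * u ^ 3 * w ^ 2 - 180 * u ^ 2 * v * w ^ 2 + 160 * u * v ^ 2 * w ^ 2
      + 48 * v ^ 3 * w ^ 2 + 6 * u * w ^ 4 - 10 * v * w ^ 4 = 0)
    (h2 : -50 * u ^ 5 + 412 * u ^ 4 * v - 1224 * u ^ 3 * v ^ 2 + 1284 * u ^ 2 * v ^ 3 + 50 * u * v ^ 4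
      - 600 * v ^ 5
      - 60 * u ^ 3 * w ^ 2 + 160 * u ^ 2 * v * w ^ 2 + 144 * u * v ^ 2 * w ^ 2
      + 60 * v ^ 3 * w ^ 2 - 10 * u * w ^ 4 + 12 * v * w ^ 4 = 0) :
    u * v = 0 := by
  refine (mul_eq_zero.1 (?_ : u * v * w ^ 8 = 0)).resolve_right (pow_ne_zero 8 hw)
  linear_combination
    (2300869 / 75264 * v ^ 6 - 7328561 / 376320 * u * v ^ 5 - 192697 / 6272 * u ^ 2 * v ^ 4 +
      3270181 / 94080 * u ^ 3 * v ^ 3 - 1604809 / 125440 * u ^ 4 * v ^ 2 + 102223 / 75264 * u ^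
      5 * v + 321 / 3136 * u ^ 6 + 1867231 / 376320 * v ^ 4 * w ^ 2 - 265751 / 125440 * u * v ^
      3 * w ^ 2 - 5307 / 25088 * u ^ 2 * v ^ 2 * w ^ 2 - 12769 / 376320 * u ^ 3 * v * w ^ 2 +
      321 / 15680 * u ^ 4 * w ^ 2 - 1 / 3 * u * v * w ^ 4) * h0 + (14253 / 7168 * v ^ 5 -
      1617391 / 376320 * u * v ^ 4 - 3485879 / 376320 * u ^ 2 * v ^ 3 + 1935779 / 376320 * u ^ 3
      * v ^ 2 - 318373 / 752640 * u ^ 4 * v - 563 / 31360 * u ^ 5 - 81771 / 250880 * v ^ 3 * w ^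
      2 - 7607 / 4704 * u * v ^ 2 * w ^ 2 + 250951 / 752640 * u ^ 2 * v * w ^ 2 + 321 / 31360 *
      u ^ 3 * w ^ 2) * h1 + (3751 / 4704 * v ^ 5 + 767923 / 188160 * u * v ^ 4 - 943231 / 188160
      * u ^ 2 * v ^ 3 + 6019 / 5376 * u ^ 3 * v ^ 2 + 81 / 3920 * u ^ 4 * v + 3 / 392 * u ^ 5 +
      182297 / 188160 * v ^ 3 * w ^ 2 - 7195 / 12544 * u * v ^ 2 * w ^ 2) * h2

theorem sexticGradientVanishes_iff {u v w : ℂ} :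
    SexticGradientVanishes u v w ↔
      (u = 0 ∧ v = 0 ∧ w = 0) ∨ (v = 0 ∧ u ^ 2 + w ^ 2 = 0) ∨ (u = 0 ∧ 5 * v ^ 2 - w ^ 2 = 0) := by
  constructor
  · rintro ⟨h1, h2, h0⟩
    by_cases hw : w = 0
    · subst hw
      obtain ⟨hu, hv⟩ := u_eq_zero_and_v_eq_zero_of_binary_sextic (u := u) (v := v)
        (by linear_combination h1) (by linear_combination h2)
      exact Or.inl ⟨hu, hv, rfl⟩
    replace h0 := (mul_eq_zero.1 h0).resolve_left (mul_ne_zero two_ne_zero hw)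
    right
    rcases mul_eq_zero.1 (mul_eq_zero_of_sextic_gradient hw h0 h1 h2) with rfl | rfl
    · refine Or.inr ⟨rfl, by_contra fun h => hw ?_⟩
      have ha : v ^ 2 + w ^ 2 = 0 := (mul_eq_zero.1
        (by linear_combination h0 / 3 : (5 * v ^ 2 - w ^ 2) * (v ^ 2 + w ^ 2) = 0)).resolve_left h
      have hb : v * (10 * v ^ 2 + w ^ 2) = 0 := (mul_eq_zero.1
        (by linear_combination -h2 / 12 :
          (5 * v ^ 2 - w ^ 2) * (v * (10 * v ^ 2 + w ^ 2)) = 0)).resolve_left h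
      refine pow_eq_zero_iff (n := 4) (by norm_num) |>.1 ?_
      linear_combination (w ^ 2 - 10 / 9 * v ^ 2) * ha + v / 9 * hb
    · refine Or.inl ⟨rfl, by_contra fun h => hw ?_⟩
      have ha : 3 * u ^ 2 - w ^ 2 = 0 := (mul_eq_zero.1
        (by linear_combination h0 / 3 : (u ^ 2 + w ^ 2) * (3 * u ^ 2 - w ^ 2) = 0)).resolve_left h
      have hb : u * (5 * u ^ 2 + w ^ 2) = 0 := (mul_eq_zero.1
        (by linear_combination h1 / 6 :
          (u ^ 2 + w ^ 2) * (u * (5 * u ^ 2 + w ^ 2)) = 0)).resolve_left h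
      refine pow_eq_zero_iff (n := 4) (by norm_num) |>.1 ?_
      linear_combination (-w ^ 2 - 3 * u ^ 2 + 9 / 8 * u ^ 2) * ha + 9 / 8 * u * hb
  · rintro (⟨rfl, rfl, rfl⟩ | ⟨rfl, h⟩ | ⟨rfl, h⟩)
    · simp [SexticGradientVanishes]
    · refine ⟨?_, ?_, ?_⟩
      · linear_combination 6 * u * (5 * u ^ 2 + w ^ 2) * h
      · linear_combination -10 * u * (5 * u ^ 2 + w ^ 2) * h
      · linear_combination 6 * w * (3 * u ^ 2 - w ^ 2) * h
    · refine ⟨?_, ?_, ?_⟩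
      · linear_combination 2 * v * (v ^ 2 + 5 * w ^ 2) * h
      · linear_combination -12 * v * (10 * v ^ 2 + w ^ 2) * h
      · linear_combination 6 * w * (v ^ 2 + w ^ 2) * h

/-- The singular locus of the plane sextic `D` consists exactly of the four
points `(±i : 0 : 1)` and `(0 : ±1/√5 : 1)`. -/
theorem singular_points_of_sexticD (x : Fin 3 → ℂ) (hx : x ≠ 0) :
    (∀ i : Fin 3, eval x (pderiv i sexticD) = 0) ↔
      ∃ c : ℂ, c ≠ 0 ∧
        (x = c • ![Complex.I, 0, 1] ∨
         x = c • ![-Complex.I, 0, 1] ∨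
         x = c • ![0, 1 / (Real.sqrt 5 : ℂ), 1] ∨
         x = c • ![0, -(1 / (Real.sqrt 5 : ℂ)), 1]) := by
  have hI : Complex.I ^ 2 = -1 := Complex.I_sq
  have hs : (Real.sqrt 5 : ℂ) ^ 2 = 5 := by
    rw [← Complex.ofReal_pow, Real.sq_sqrt (by norm_num)]
    norm_num
  have hs0 : (Real.sqrt 5 : ℂ) ≠ 0 := fun h => by simp [h] at hs
  have hext (c a b : ℂ) : x = c • ![a, b, 1] ↔ x 0 = c * a ∧ x 1 = c * b ∧ x 2 = c := by
    simp [funext_iff, Fin.forall_fin_succ]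
  have hx0 : ¬(x 0 = 0 ∧ x 1 = 0 ∧ x 2 = 0) := fun h => hx <| by
    ext i
    fin_cases i
    exacts [h.1, h.2.1, h.2.2]
  rw [forall_eval_pderiv_sexticD_eq_zero_iff, sexticGradientVanishes_iff]
  simp only [hext]
  constructor
  · rintro (h | ⟨hv, h⟩ | ⟨hu, h⟩)
    · exact absurd h hx0
    · refine ⟨x 2, fun hw => hx0 ⟨by simpa [hw] using h, hv, hw⟩, ?_⟩
      rcases mul_eq_zero.1 (by linear_combination h - x 2 ^ 2 * hI :
        (x 0 - x 2 * Complex.I) * (x 0 + x 2 * Complex.I) = 0) with h | h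
      · exact Or.inl ⟨by linear_combination h, by simpa using hv, rfl⟩
      · exact Or.inr (Or.inl ⟨by linear_combination h, by simpa using hv, rfl⟩)
    · refine ⟨x 2, fun hw => hx0 ⟨hu, by simpa [hw] using h, hw⟩, Or.inr (Or.inr ?_)⟩
      rcases mul_eq_zero.1 (by linear_combination h + x 1 ^ 2 * hs :
        (Real.sqrt 5 * x 1 - x 2) * (Real.sqrt 5 * x 1 + x 2) = 0) with h | h
      · refine Or.inl ⟨by simpa using hu, ?_, rfl⟩
        field_simp
        linear_combination h
      · refine Or.inr ⟨by simpa using hu, ?_, rfl⟩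
        field_simp
        linear_combination h
  · rintro ⟨c, -, ⟨hu, hv, hw⟩ | ⟨hu, hv, hw⟩ | ⟨hu, hv, hw⟩ | ⟨hu, hv, hw⟩⟩ <;>
      rw [hu, hv, hw]
    · exact Or.inr (Or.inl ⟨mul_zero c, by linear_combination c ^ 2 * hI⟩)
    · exact Or.inr (Or.inl ⟨mul_zero c, by linear_combination c ^ 2 * hI⟩)
    · refine Or.inr (Or.inr ⟨mul_zero c, ?_⟩)
      field_simp
      linear_combination -c ^ 2 * hs
    · refine Or.inr (Or.inr ⟨mul_zero c, ?_⟩)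
      field_simp
      linear_combination -c ^ 2 * hs
end

section
/- Let p₁ = (i : 0 : 1), p₂ = (−i : 0 : 1), p₃ = (0 : 1/√5 : 1), p₄ = (0 : −1/√5 : 1) in P²(ℂ). If M ∈ GL₃(ℚ) is such that the induced projective linear map of P²(ℂ) permutes the set {p₁, p₂, p₃, p₄}, then M is a nonzero rational scalar multiple of one of the diagonal matrices diag(1,1,1), diag(−1,1,1), diag(1,−1,1), diag(−1,−1,1). -/
open Matrix

/-- The four singular points `p₁ = (i:0:1)`, `p₂ = (−i:0:1)`, `p₃ = (0:1/√5:1)`,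
`p₄ = (0:−1/√5:1)` of the sextic model `D`, as homogeneous coordinate vectors. -/
noncomputable def singPts : Fin 4 → Fin 3 → ℂ :=
  ![![Complex.I, 0, 1], ![-Complex.I, 0, 1],
    ![0, 1 / (Real.sqrt 5 : ℂ), 1], ![0, -(1 / (Real.sqrt 5 : ℂ)), 1]]

/-- The numbers `1`, `i`, `1/√5`, `i/√5` are linearly independent over `ℚ`. -/
theorem rat_combination_eq_zero {x y z w : ℚ}
    (h : (x : ℂ) + y * Complex.I + (z + w * Complex.I) * (1 / (Real.sqrt 5 : ℂ)) = 0) :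
    x = 0 ∧ y = 0 ∧ z = 0 ∧ w = 0 := by
  have hirr : Irrational (Real.sqrt 5) := by
    simpa using Nat.Prime.irrational_sqrt (p := 5) (by norm_num)
  have hs : Real.sqrt 5 ≠ 0 := by positivity
  have real_case : ∀ u v : ℚ, (u : ℝ) * Real.sqrt 5 + v = 0 → u = 0 ∧ v = 0 := by
    intro u v huv
    have hu : u = 0 := by
      by_contra hu
      refine hirr ⟨-v / u, ?_⟩
      have hu' : (u : ℝ) ≠ 0 := by exact_mod_cast hu
      push_cast
      field_simp
      linarith
    subst hu
    exact ⟨rfl, by simpa using huv⟩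
  have hsC : (Real.sqrt 5 : ℂ) ≠ 0 := by exact_mod_cast hs
  have h' : (((x : ℝ) * Real.sqrt 5 + z : ℝ) : ℂ)
      + (((y : ℝ) * Real.sqrt 5 + w : ℝ) : ℂ) * Complex.I = 0 := by
    field_simp at h
    push_cast
    linear_combination h
  obtain ⟨hx, hz⟩ := real_case x z (by simpa using congrArg Complex.re h')
  obtain ⟨hy, hw⟩ := real_case y w (by simpa using congrArg Complex.im h')
  exact ⟨hx, hy, hz, hw⟩

/-- Relations among the entries of a rational matrix sending `p₁` to one of the four points. -/
theorem entries_of_mulVec_singPts_zero {M : Matrix (Fin 3) (Fin 3) ℚ} {c : ℂ} (hc : c ≠ 0)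
    {j : Fin 4} (h : (M.map (fun q : ℚ => (q : ℂ))).mulVec (singPts 0) = c • singPts j) :
    M 1 0 = 0 ∧ M 1 2 = 0 ∧
      (M 0 2 = -M 2 0 ∧ M 0 0 = M 2 2 ∨ M 0 2 = M 2 0 ∧ M 0 0 = -M 2 2) := by
  have h0 := congrFun h 0
  have h1 := congrFun h 1
  have h2 := congrFun h 2
  fin_cases j <;>
    simp [singPts, mulVec, dotProduct, Fin.sum_univ_three, -one_div] at h0 h1 h2
  · obtain ⟨hf, hd, -⟩ := rat_combination_eq_zero (x := M 1 2) (y := M 1 0) (z := 0) (w := 0)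
      (by push_cast; linear_combination h1)
    obtain ⟨hx, hy, -⟩ := rat_combination_eq_zero
      (x := M 0 2 + M 2 0) (y := M 0 0 - M 2 2) (z := 0) (w := 0)
      (by push_cast; linear_combination h0 - Complex.I * h2 + M 2 0 * Complex.I_mul_I)
    exact ⟨hd, hf, .inl ⟨by linarith, by linarith⟩⟩
  · obtain ⟨hf, hd, -⟩ := rat_combination_eq_zero (x := M 1 2) (y := M 1 0) (z := 0) (w := 0)
      (by push_cast; linear_combination h1)
    obtain ⟨hx, hy, -⟩ := rat_combination_eq_zero
      (x := M 0 2 - M 2 0) (y := M 0 0 + M 2 2) (z := 0) (w := 0)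
      (by push_cast; linear_combination h0 + Complex.I * h2 - M 2 0 * Complex.I_mul_I)
    exact ⟨hd, hf, .inr ⟨by linarith, by linarith⟩⟩
  · obtain ⟨-, -, hk, hg⟩ := rat_combination_eq_zero
      (x := M 1 2) (y := M 1 0) (z := -M 2 2) (w := -M 2 0)
      (by push_cast; linear_combination h1 - (1 / (Real.sqrt 5 : ℂ)) * h2)
    exact absurd (by rw [← h2, neg_eq_zero.mp hk, neg_eq_zero.mp hg]; simp) hc
  · obtain ⟨-, -, hk, hg⟩ := rat_combination_eq_zero
      (x := M 1 2) (y := M 1 0) (z := M 2 2) (w := M 2 0)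
      (by linear_combination h1 + (1 / (Real.sqrt 5 : ℂ)) * h2)
    exact absurd (by rw [← h2, hk, hg]; simp) hc

/-- Relations among the entries of a rational matrix sending `p₃` to one of the four points. -/
theorem entries_of_mulVec_singPts_two {M : Matrix (Fin 3) (Fin 3) ℚ} {c : ℂ} (hc : c ≠ 0)
    {j : Fin 4} (h : (M.map (fun q : ℚ => (q : ℂ))).mulVec (singPts 2) = c • singPts j) :
    M 0 1 = 0 ∧ M 0 2 = 0 ∧
      (5 * M 1 2 = M 2 1 ∧ M 1 1 = M 2 2 ∨ 5 * M 1 2 = -M 2 1 ∧ M 1 1 = -M 2 2) := by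
  have hs : (1 / (Real.sqrt 5 : ℂ)) * (1 / (Real.sqrt 5 : ℂ)) = 1 / 5 := by
    rw [div_mul_div_comm, ← Complex.ofReal_mul, Real.mul_self_sqrt (by norm_num)]
    norm_num
  have h0 := congrFun h 0
  have h1 := congrFun h 1
  have h2 := congrFun h 2
  fin_cases j <;>
    simp [singPts, mulVec, dotProduct, Fin.sum_univ_three, -one_div] at h0 h1 h2
  · obtain ⟨-, hk, -, hh⟩ := rat_combination_eq_zero
      (x := M 0 2) (y := -M 2 2) (z := M 0 1) (w := -M 2 1)
      (by push_cast; linear_combination h0 - Complex.I * h2)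
    exact absurd (by rw [← h2, neg_eq_zero.mp hk, neg_eq_zero.mp hh]; simp) hc
  · obtain ⟨-, hk, -, hh⟩ := rat_combination_eq_zero
      (x := M 0 2) (y := M 2 2) (z := M 0 1) (w := M 2 1)
      (by linear_combination h0 + Complex.I * h2)
    exact absurd (by rw [← h2, hk, hh]; simp) hc
  · obtain ⟨hc0, -, hb, -⟩ := rat_combination_eq_zero (x := M 0 2) (y := 0) (z := M 0 1) (w := 0)
      (by push_cast; linear_combination h0)
    obtain ⟨hx, -, hz, -⟩ := rat_combination_eq_zero
      (x := M 1 2 - M 2 1 / 5) (y := 0) (z := M 1 1 - M 2 2) (w := 0)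
      (by push_cast; linear_combination h1 - (1 / (Real.sqrt 5 : ℂ)) * h2 + M 2 1 * hs)
    exact ⟨hb, hc0, .inl ⟨by linarith, by linarith⟩⟩
  · obtain ⟨hc0, -, hb, -⟩ := rat_combination_eq_zero (x := M 0 2) (y := 0) (z := M 0 1) (w := 0)
      (by push_cast; linear_combination h0)
    obtain ⟨hx, -, hz, -⟩ := rat_combination_eq_zero
      (x := M 1 2 + M 2 1 / 5) (y := 0) (z := M 1 1 + M 2 2) (w := 0)
      (by push_cast; linear_combination h1 + (1 / (Real.sqrt 5 : ℂ)) * h2 - M 2 1 * hs)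
    exact ⟨hb, hc0, .inr ⟨by linarith, by linarith⟩⟩

/-- A matrix in `GL₃(ℚ)` whose induced projective linear action on `P²(ℂ)` permutes
the four points `p₁, p₂, p₃, p₄` is a nonzero rational scalar multiple of one of
`diag(1,1,1)`, `diag(−1,1,1)`, `diag(1,−1,1)`, `diag(−1,−1,1)`. -/
theorem matrices_permuting_singular_points
    (M : Matrix (Fin 3) (Fin 3) ℚ) (hM : IsUnit M.det)
    (hperm : ∃ σ : Equiv.Perm (Fin 4), ∀ i : Fin 4, ∃ c : ℂ, c ≠ 0 ∧
      (M.map (fun q : ℚ => (q : ℂ))).mulVec (singPts i) = c • singPts (σ i)) :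
    ∃ q : ℚ, q ≠ 0 ∧
      (M = q • (1 : Matrix (Fin 3) (Fin 3) ℚ) ∨
       M = q • Matrix.diagonal ![-1, 1, 1] ∨
       M = q • Matrix.diagonal ![1, -1, 1] ∨
       M = q • Matrix.diagonal ![-1, -1, 1]) := by
  obtain ⟨σ, hσ⟩ := hperm
  obtain ⟨c, hc, h0⟩ := hσ 0
  obtain ⟨c', hc', h2⟩ := hσ 2
  obtain ⟨hd, hf, hp⟩ := entries_of_mulVec_singPts_zero hc h0
  obtain ⟨hb, hc0, hq⟩ := entries_of_mulVec_singPts_two hc' h2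
  have hg : M 2 0 = 0 := by rcases hp with hp | hp <;> linarith [hp.1]
  have hh : M 2 1 = 0 := by rcases hq with hq | hq <;> linarith [hq.1]
  have hk : M 2 2 ≠ 0 := by
    intro hk
    simp [det_fin_three, hg, hh, hk] at hM
  refine ⟨M 2 2, hk, ?_⟩
  rcases hp with ⟨-, ha⟩ | ⟨-, ha⟩ <;> rcases hq with ⟨-, he⟩ | ⟨-, he⟩
  · left
    ext i j
    fin_cases i <;> fin_cases j <;> simp [*]
  · right; right; left
    ext i j
    fin_cases i <;> fin_cases j <;> simp [*]
  · right; left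
    ext i j
    fin_cases i <;> fin_cases j <;> simp [*]
  · right; right; right
    ext i j
    fin_cases i <;> fin_cases j <;> simp [*]
end

section
/- Let M ∈ GL₃(ℚ) be such that the induced projective linear map of P²(ℂ) maps the zero locus in P²(ℂ) of the sextic F(u,v,w) = 5u⁶ − 50u⁵v + 206u⁴v² − 408u³v³ + 321u²v⁴ + 10uv⁵ − 100v⁶ + 9u⁴w² − 60u³vw² + 80u²v²w² + 48uv³w² + 15v⁴w² + 3u²w⁴ − 10uvw⁴ + 6v²w⁴ − w⁶ into itself. Then M is a nonzero rational scalar multiple of the identity matrix or of diag(−1,−1,1). (This is the linear-automorphism content of the lemma that Aut_ℚ(X(b5,ns7)) = ⟨w₅⟩ ≅ ℤ/2ℤ, where w₅ acts on the model D by (u:v:w) ↦ (−u:−v:w).) -/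
open Matrix

/-- The homogeneous sextic defining the plane model `D` of `X(b5,ns7)`,
evaluated at a homogeneous coordinate vector over `ℂ`. -/
def sexticF (x : Fin 3 → ℂ) : ℂ :=
  5 * x 0 ^ 6 - 50 * x 0 ^ 5 * x 1 + 206 * x 0 ^ 4 * x 1 ^ 2 - 408 * x 0 ^ 3 * x 1 ^ 3
    + 321 * x 0 ^ 2 * x 1 ^ 4 + 10 * x 0 * x 1 ^ 5 - 100 * x 1 ^ 6
    + 9 * x 0 ^ 4 * x 2 ^ 2 - 60 * x 0 ^ 3 * x 1 * x 2 ^ 2 + 80 * x 0 ^ 2 * x 1 ^ 2 * x 2 ^ 2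
    + 48 * x 0 * x 1 ^ 3 * x 2 ^ 2 + 15 * x 1 ^ 4 * x 2 ^ 2
    + 3 * x 0 ^ 2 * x 2 ^ 4 - 10 * x 0 * x 1 * x 2 ^ 4 + 6 * x 1 ^ 2 * x 2 ^ 4 - x 2 ^ 6

section GenericForm

variable {R : Type*} [CommRing R]

/-- The sextic form `F` over an arbitrary commutative ring. -/
def sexticForm (u v w : R) : R :=
  5 * u ^ 6 - 50 * u ^ 5 * v + 206 * u ^ 4 * v ^ 2 - 408 * u ^ 3 * v ^ 3
    + 321 * u ^ 2 * v ^ 4 + 10 * u * v ^ 5 - 100 * v ^ 6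
    + 9 * u ^ 4 * w ^ 2 - 60 * u ^ 3 * v * w ^ 2 + 80 * u ^ 2 * v ^ 2 * w ^ 2
    + 48 * u * v ^ 3 * w ^ 2 + 15 * v ^ 4 * w ^ 2
    + 3 * u ^ 2 * w ^ 4 - 10 * u * v * w ^ 4 + 6 * v ^ 2 * w ^ 4 - w ^ 6

lemma map_sexticForm {S : Type*} [CommRing S] (f : R →+* S) (u v w : R) :
    f (sexticForm u v w) = sexticForm (f u) (f v) (f w) := by
  simp [sexticForm, map_ofNat]

/-- Coefficient of `w ^ 0` in `sexticForm u v w`. -/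
def fiberCoeff₀ (u v : R) : R :=
  5 * u ^ 6 - 50 * u ^ 5 * v + 206 * u ^ 4 * v ^ 2 - 408 * u ^ 3 * v ^ 3
    + 321 * u ^ 2 * v ^ 4 + 10 * u * v ^ 5 - 100 * v ^ 6

/-- Coefficient of `w ^ 2` in `sexticForm u v w`. -/
def fiberCoeff₂ (u v : R) : R :=
  9 * u ^ 4 - 60 * u ^ 3 * v + 80 * u ^ 2 * v ^ 2 + 48 * u * v ^ 3 + 15 * v ^ 4

/-- Coefficient of `w ^ 4` in `sexticForm u v w`. -/
def fiberCoeff₄ (u v : R) : R :=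
  3 * u ^ 2 - 10 * u * v + 6 * v ^ 2

lemma sexticForm_eq_fiber (u v w : R) :
    sexticForm u v w = -w ^ 6 + fiberCoeff₄ u v * w ^ 4 + fiberCoeff₂ u v * w ^ 2
      + fiberCoeff₀ u v := by
  simp only [sexticForm, fiberCoeff₀, fiberCoeff₂, fiberCoeff₄]
  ring

/-- Up to a constant, the discriminant of the monic cubic `X³ + b X² + c X + d`. -/
def cubicDisc (b c d : R) : R :=
  3 * (9 * d - b * c) ^ 2 - 2 * b * (6 * c - 2 * b ^ 2) * (9 * d - b * c)
    + c * (6 * c - 2 * b ^ 2) ^ 2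

lemma cubicDisc_eq_zero_of_double_root {b c d x : R}
    (h : x ^ 3 + b * x ^ 2 + c * x + d = 0) (h' : 3 * x ^ 2 + 2 * b * x + c = 0) :
    cubicDisc b c d = 0 := by
  unfold cubicDisc
  linear_combination (6 * c - 2 * b ^ 2) ^ 2 * h'
    - (3 * (6 * c - 2 * b ^ 2) * x + 2 * b * (6 * c - 2 * b ^ 2) - 3 * (9 * d - b * c))
      * (9 * h - (3 * x + b) * h')

/-- A form in `u, v` that vanishes wherever `sexticForm u v w` has a multiple root in `w`. -/
def fiberDisc (u v : R) : R :=
  fiberCoeff₀ u v * cubicDisc (-fiberCoeff₄ u v) (-fiberCoeff₂ u v) (-fiberCoeff₀ u v)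

lemma map_fiberDisc {S : Type*} [CommRing S] (f : R →+* S) (u v : R) :
    f (fiberDisc u v) = fiberDisc (f u) (f v) := by
  simp [fiberDisc, cubicDisc, fiberCoeff₀, fiberCoeff₂, fiberCoeff₄, map_ofNat]

/-- The partial derivatives of `sexticForm`. -/
def sexticGrad (x : Fin 3 → R) : Fin 3 → R :=
  let u := x 0
  let v := x 1
  let w := x 2
  ![30 * u ^ 5 - 250 * u ^ 4 * v + 824 * u ^ 3 * v ^ 2 - 1224 * u ^ 2 * v ^ 3
      + 642 * u * v ^ 4 + 10 * v ^ 5 + 36 * u ^ 3 * w ^ 2 - 180 * u ^ 2 * v * w ^ 2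
      + 160 * u * v ^ 2 * w ^ 2 + 48 * v ^ 3 * w ^ 2 + 6 * u * w ^ 4 - 10 * v * w ^ 4,
    -50 * u ^ 5 + 412 * u ^ 4 * v - 1224 * u ^ 3 * v ^ 2 + 1284 * u ^ 2 * v ^ 3
      + 50 * u * v ^ 4 - 600 * v ^ 5 - 60 * u ^ 3 * w ^ 2 + 160 * u ^ 2 * v * w ^ 2
      + 144 * u * v ^ 2 * w ^ 2 + 60 * v ^ 3 * w ^ 2 - 10 * u * w ^ 4 + 12 * v * w ^ 4,
    18 * u ^ 4 * w - 120 * u ^ 3 * v * w + 160 * u ^ 2 * v ^ 2 * w + 96 * u * v ^ 3 * w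
      + 30 * v ^ 4 * w + 12 * u ^ 2 * w ^ 3 - 40 * u * v * w ^ 3 + 24 * v ^ 2 * w ^ 3
      - 6 * w ^ 5]

lemma sexticGrad_eq_zero_of_sq_eq_five {s : R} (hs : s ^ 2 = 5) : sexticGrad ![0, 1, s] = 0 := by
  ext i
  fin_cases i <;> simp [sexticGrad]
  · linear_combination (-10 * s ^ 2 - 2) * hs
  · linear_combination (12 * s ^ 2 + 120) * hs
  · linear_combination (-6 * s ^ 3 - 6 * s) * hs

lemma sexticGrad_eq_zero_of_sq_eq_neg_one {s : R} (hs : s ^ 2 = -1) :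
    sexticGrad ![1, 0, s] = 0 := by
  ext i
  fin_cases i <;> simp [sexticGrad]
  · linear_combination (6 * s ^ 2 + 30) * hs
  · linear_combination (-10 * s ^ 2 - 50) * hs
  · linear_combination (-6 * s ^ 3 + 18 * s) * hs

end GenericForm

lemma sexticF_eq_sexticForm (x : Fin 3 → ℂ) : sexticF x = sexticForm (x 0) (x 1) (x 2) := rfl

section SingularPoints

variable {K : Type*} [Field K] [CharZero K]

/-- The singular points of the sextic lie on `u = 0` or `v = 0`, namely they are
`(0 : 1 : ±√5)` and `(1 : 0 : ±i)`. -/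
lemma singular_point_of_sexticGrad_eq_zero {x : Fin 3 → K} (h : sexticGrad x = 0) :
    (x 0 = 0 ∧ x 2 ^ 2 = 5 * x 1 ^ 2) ∨ (x 1 = 0 ∧ x 2 ^ 2 = -x 0 ^ 2) := by
  have h0 := congrFun h 0
  have h1 := congrFun h 1
  have h2 := congrFun h 2
  simp only [sexticGrad, Matrix.cons_val, Pi.zero_apply] at h0 h1 h2
  generalize x 0 = u at *
  generalize x 1 = v at *
  generalize x 2 = w at *
  have huv : u ^ 3 * v ^ 8 = 0 := by
    have : (4609920 : K) * (u ^ 3 * v ^ 8) = 0 := by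
      linear_combination
        (- 126300 * u ^ 6 + 1863712 * u ^ 5 * v - 9878069 * u ^ 4 * v ^ 2 + 23390333 *
          u ^ 3 * v ^ 3 - 20947167 * u ^ 2 * v ^ 4 - 2495085 * u * v ^ 5 + 9773100 * v
          ^ 6 - 220989 * u ^ 4 * w ^ 2 + 2059881 * u ^ 3 * v * w ^ 2 - 3451821 * u ^ 2
          * v ^ 2 * w ^ 2 - 2885250 * u * v ^ 3 * w ^ 2 - 774945 * v ^ 4 * w ^ 2 +
          31563 * u ^ 2 * w ^ 4 - 36855 * u * v * w ^ 4 - 235935 * v ^ 2 * w ^ 4) * h0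
        + (- 75780 * u ^ 6 + 1125300 * u ^ 5 * v - 6199259 * u ^ 4 * v ^ 2 + 16655074
          * u ^ 3 * v ^ 3 - 21738310 * u ^ 2 * v ^ 4 + 10429206 * u * v ^ 5 + 162885 *
          v ^ 6 - 75780 * u ^ 4 * w ^ 2 + 1125204 * u ^ 3 * v * w ^ 2 - 3930042 * u ^
          2 * v ^ 2 * w ^ 2 + 3027702 * u * v ^ 3 * w ^ 2 + 913326 * v ^ 4 * w ^ 2 -
          13419 * v ^ 2 * w ^ 4) * h1
        + (157815 * u ^ 5 * w - 1156064 * u ^ 4 * v * w + 2999794 * u ^ 3 * v ^ 2 * w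
          - 2659321 * u ^ 2 * v ^ 3 * w - 1392657 * u * v ^ 4 * w + 2562105 * v ^ 5 *
          w + 31563 * u ^ 3 * w ^ 3 - 89460 * u ^ 2 * v * w ^ 3 - 152145 * u * v ^ 2 *
          w ^ 3 + 366387 * v ^ 3 * w ^ 3) * h2
    simpa using this
  have huv' : u = 0 ∨ v = 0 := by simpa using huv
  rcases huv' with rfl | rfl
  · refine Or.inl ⟨rfl, ?_⟩
    by_contra hne
    have hne' : w ^ 2 - 5 * v ^ 2 ≠ 0 := sub_ne_zero.2 hne
    have hw : w * (w ^ 2 + v ^ 2) = 0 := by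
      have : (6 : K) * (w ^ 2 - 5 * v ^ 2) * (w * (w ^ 2 + v ^ 2)) = 0 := by
        linear_combination -h2
      simpa [hne'] using this
    have hv : v * (w ^ 2 + 10 * v ^ 2) = 0 := by
      have : (12 : K) * (w ^ 2 - 5 * v ^ 2) * (v * (w ^ 2 + 10 * v ^ 2)) = 0 := by
        linear_combination h1
      simpa [hne'] using this
    have hv0 : v ^ 3 * w = 0 := by
      have : (9 : K) * (v ^ 3 * w) = 0 := by linear_combination w * hv - v * hw
      simpa using this
    rcases (by simpa using hv0 : v = 0 ∨ w = 0) with rfl | rfl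
    · exact hne (by simpa using hw)
    · have : v = 0 := by simpa using hv
      simp [this] at hne
  · refine Or.inr ⟨rfl, ?_⟩
    by_contra hne
    have hne' : w ^ 2 + u ^ 2 ≠ 0 := fun h => hne (eq_neg_of_add_eq_zero_left h)
    have hw : w * (w ^ 2 - 3 * u ^ 2) = 0 := by
      have : (6 : K) * (w ^ 2 + u ^ 2) * (w * (w ^ 2 - 3 * u ^ 2)) = 0 := by
        linear_combination -h2
      simpa [hne'] using this
    have hu : u * (w ^ 2 + 5 * u ^ 2) = 0 := by
      have : (6 : K) * (w ^ 2 + u ^ 2) * (u * (w ^ 2 + 5 * u ^ 2)) = 0 := by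
        linear_combination h0
      simpa [hne'] using this
    have hu0 : u ^ 3 * w = 0 := by
      have : (8 : K) * (u ^ 3 * w) = 0 := by linear_combination w * hu - u * hw
      simpa using this
    rcases (by simpa using hu0 : u = 0 ∨ w = 0) with rfl | rfl
    · exact hne (by simpa using hw)
    · have : u = 0 := by simpa using hu
      simp [this] at hne

end SingularPoints

lemma hasDerivAt_sexticF_line (x z : Fin 3 → ℂ) :
    HasDerivAt (fun s : ℂ => sexticF (x + s • z)) (sexticGrad x ⬝ᵥ z) 0 := by
  have hl : ∀ i, HasDerivAt (fun s : ℂ => x i + s * z i) (z i) 0 := fun i => by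
    simpa using ((hasDerivAt_id (0 : ℂ)).mul_const (z i)).const_add (x i)
  have m := fun (k : ℂ) (a b c : ℕ) =>
    ((((hl 0).fun_pow a).fun_mul ((hl 1).fun_pow b)).fun_mul ((hl 2).fun_pow c)).const_mul k
  have hsum := (m 5 6 0 0).fun_add <| (m (-50) 5 1 0).fun_add <| (m 206 4 2 0).fun_add <|
    (m (-408) 3 3 0).fun_add <| (m 321 2 4 0).fun_add <| (m 10 1 5 0).fun_add <|
    (m (-100) 0 6 0).fun_add <| (m 9 4 0 2).fun_add <| (m (-60) 3 1 2).fun_add <|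
    (m 80 2 2 2).fun_add <| (m 48 1 3 2).fun_add <| (m 15 0 4 2).fun_add <|
    (m 3 2 0 4).fun_add <| (m (-10) 1 1 4).fun_add <| (m 6 0 2 4).fun_add (m (-1) 0 0 6)
  refine (hsum.congr_deriv ?_).congr_of_eventuallyEq (.of_forall fun s => ?_)
  swap
  · simp only [sexticF, Pi.add_apply, Pi.smul_apply, smul_eq_mul]
    ring
  · simp [sexticGrad, dotProduct, Fin.sum_univ_three]
    ring

section Fibers

open Polynomial

lemma separable_sexticForm_fiber {u v : ℂ} (h : fiberDisc u v ≠ 0) :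
    (sexticForm (C u) (C v) X : ℂ[X]).Separable := by
  rw [Polynomial.Separable, Polynomial.isCoprime_iff_aeval_ne_zero_of_isAlgClosed ℂ ℂ]
  intro w
  by_contra! hw
  obtain ⟨h1, h2⟩ := hw
  rw [← AlgHom.coe_toRingHom, map_sexticForm] at h1
  simp only [sexticForm_eq_fiber, AlgHom.coe_toRingHom, aeval_X, aeval_C,
    Algebra.algebraMap_self, RingHom.id_apply] at h1
  have hder : -6 * w ^ 5 + 4 * fiberCoeff₄ u v * w ^ 3 + 2 * fiberCoeff₂ u v * w = 0 := by
    rw [← h2]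
    simp [sexticForm, fiberCoeff₄, fiberCoeff₂, derivative_pow]
    ring
  apply h
  unfold fiberDisc
  by_cases hw : w = 0
  · subst hw
    have : fiberCoeff₀ u v = 0 := by simpa using h1
    simp [this]
  · have hder' : 3 * (w ^ 2) ^ 2 + 2 * (-fiberCoeff₄ u v) * w ^ 2 + -fiberCoeff₂ u v = 0 := by
      have : (2 * w) * (3 * (w ^ 2) ^ 2 + 2 * (-fiberCoeff₄ u v) * w ^ 2
          + -fiberCoeff₂ u v) = 0 := by
        linear_combination -hder
      simpa [hw] using this
    rw [cubicDisc_eq_zero_of_double_root (x := w ^ 2) (by linear_combination -h1) hder', mul_zero]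

lemma natDegree_sexticForm_fiber (u v : ℂ) :
    (sexticForm (C u) (C v) X : ℂ[X]).natDegree = 6 := by
  unfold sexticForm
  compute_degree!

lemma coeff_sexticForm_fiber (u v : ℂ) :
    (sexticForm (C u) (C v) X : ℂ[X]).coeff 6 = -1 := by
  unfold sexticForm
  compute_degree!

lemma natDegree_sexticForm_linear_le (a b c a' b' c' : ℂ) :
    (sexticForm (C a * X + C a') (C b * X + C b') (C c * X + C c') : ℂ[X]).natDegree ≤ 6 := by
  unfold sexticForm
  compute_degree

lemma coeff_sexticForm_linear (a b c a' b' c' : ℂ) :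
    (sexticForm (C a * X + C a') (C b * X + C b') (C c * X + C c') : ℂ[X]).coeff 6
      = sexticForm a b c := by
  unfold sexticForm
  compute_degree!

lemma eq_C_mul_of_root_imp {p q : ℂ[X]} (hp : p.Separable) (hdeg : q.natDegree ≤ p.natDegree)
    (hroot : ∀ w, p.eval w = 0 → q.eval w = 0) : ∃ k, q = C k * p := by
  rcases eq_or_ne q 0 with rfl | hq
  · exact ⟨0, by simp⟩
  have hp0 : p ≠ 0 := hp.ne_zero
  obtain ⟨r, rfl⟩ : p ∣ q := by
    rw [IsAlgClosed.dvd_iff_roots_le_roots hp0 hq, Multiset.le_iff_subset (nodup_roots hp)]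
    intro w hw
    rw [mem_roots hp0] at hw
    rw [mem_roots hq]
    exact hroot w hw
  have hr : r ≠ 0 := right_ne_zero_of_mul hq
  rw [natDegree_mul hp0 hr] at hdeg
  obtain ⟨k, rfl⟩ := natDegree_eq_zero.1 (by omega : r.natDegree = 0)
  exact ⟨k, mul_comm _ _⟩

end Fibers

/-- A linear map sending the zero locus of `F` into itself multiplies `F` by a constant. -/
lemma sexticF_mulVec_eq_mul (N : Matrix (Fin 3) (Fin 3) ℂ)
    (h : ∀ x : Fin 3 → ℂ, x ≠ 0 → sexticF x = 0 → sexticF (N *ᵥ x) = 0) :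
    ∃ c : ℂ, ∀ x, sexticF (N *ᵥ x) = c * sexticF x := by
  refine ⟨-sexticForm (N 0 2) (N 1 2) (N 2 2), ?_⟩
  set c := -sexticForm (N 0 2) (N 1 2) (N 2 2) with hc
  have hfib : ∀ x : Fin 3 → ℂ, fiberDisc (x 0) (x 1) ≠ 0 →
      sexticF (N *ᵥ x) = c * sexticF x := by
    intro x hx
    let a : Fin 3 → ℂ := fun i => N i 0 * x 0 + N i 1 * x 1
    have hNx : ∀ y : Fin 3 → ℂ, y 0 = x 0 → y 1 = x 1 →
        ∀ i, (N *ᵥ y) i = N i 2 * y 2 + a i := by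
      intro y h0 h1 i
      simp only [Matrix.mulVec, dotProduct, Fin.sum_univ_three, h0, h1, a]
      ring
    obtain ⟨k, hk⟩ := eq_C_mul_of_root_imp (separable_sexticForm_fiber hx)
      (q := sexticForm (.C (N 0 2) * .X + .C (a 0)) (.C (N 1 2) * .X + .C (a 1))
        (.C (N 2 2) * .X + .C (a 2)))
      (by rw [natDegree_sexticForm_fiber]; exact natDegree_sexticForm_linear_le ..)
      (by
        intro w hw
        rw [← Polynomial.coe_evalRingHom, map_sexticForm] at hw ⊢
        simp only [Polynomial.coe_evalRingHom, Polynomial.eval_add, Polynomial.eval_mul,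
          Polynomial.eval_C, Polynomial.eval_X] at hw ⊢
        have hy := h ![x 0, x 1, w] (by
          intro hy
          have h0 : x 0 = 0 := congrFun hy 0
          have h1 : x 1 = 0 := congrFun hy 1
          simp [h0, h1, fiberDisc, fiberCoeff₀] at hx) hw
        rw [sexticF_eq_sexticForm] at hy
        simpa only [hNx ![x 0, x 1, w] rfl rfl, Matrix.cons_val] using hy)
    have hkc : c = k := by
      have := congrArg (Polynomial.coeff · 6) hk
      simp only [Polynomial.coeff_C_mul, coeff_sexticForm_linear, coeff_sexticForm_fiber] at this
      rw [hc, this]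
      ring
    have := congrArg (Polynomial.evalRingHom (x 2)) hk
    rw [map_mul, map_sexticForm, map_sexticForm] at this
    simp only [Polynomial.coe_evalRingHom, Polynomial.eval_add, Polynomial.eval_mul,
      Polynomial.eval_C, Polynomial.eval_X] at this
    rw [sexticF_eq_sexticForm, sexticF_eq_sexticForm, hNx x rfl rfl, hNx x rfl rfl, hNx x rfl rfl,
      this, hkc]
  let L : Fin 3 → MvPolynomial (Fin 3) ℂ := fun i => ∑ j, .C (N i j) * .X j
  let H : MvPolynomial (Fin 3) ℂ :=
    sexticForm (L 0) (L 1) (L 2) - .C c * sexticForm (.X 0) (.X 1) (.X 2)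
  have hH : ∀ x, MvPolynomial.eval x H = sexticF (N *ᵥ x) - c * sexticF x := by
    intro x
    have hL : ∀ i, MvPolynomial.eval x (L i) = (N *ᵥ x) i := by
      simp [L, Matrix.mulVec, dotProduct]
    simp only [H, map_sub, map_mul, map_sexticForm, hL, MvPolynomial.eval_C, MvPolynomial.eval_X,
      sexticF_eq_sexticForm]
  have hD : (fiberDisc (.X 0) (.X 1) : MvPolynomial (Fin 3) ℂ) ≠ 0 := by
    intro h0
    have := congrArg (MvPolynomial.eval ![1, 1, 0]) h0
    rw [map_fiberDisc] at this
    norm_num [fiberDisc, cubicDisc, fiberCoeff₀, fiberCoeff₂, fiberCoeff₄] at this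
  have hDH : (fiberDisc (.X 0) (.X 1) : MvPolynomial (Fin 3) ℂ) * H = 0 := by
    refine MvPolynomial.funext fun x => ?_
    rw [map_mul, map_fiberDisc, hH, map_zero, MvPolynomial.eval_X, MvPolynomial.eval_X,
      mul_eq_zero, sub_eq_zero]
    exact or_iff_not_imp_left.2 (hfib x)
  intro x
  rw [← sub_eq_zero, ← hH, (mul_eq_zero.1 hDH).resolve_left hD, map_zero]

lemma sexticGrad_mulVec_eq_zero {N : Matrix (Fin 3) (Fin 3) ℂ} (hN : IsUnit N.det) {c : ℂ}
    (h : ∀ x, sexticF (N *ᵥ x) = c * sexticF x) {x : Fin 3 → ℂ} (hx : sexticGrad x = 0) :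
    sexticGrad (N *ᵥ x) = 0 := by
  refine dotProduct_eq_zero _ fun z => ?_
  have h1 := hasDerivAt_sexticF_line (N *ᵥ x) z
  have h2 := (hasDerivAt_sexticF_line x (N⁻¹ *ᵥ z)).const_mul c
  rw [hx, zero_dotProduct, mul_zero] at h2
  refine h1.unique (h2.congr_of_eventuallyEq (.of_forall fun s => ?_))
  simp only [← h, Matrix.mulVec_add, Matrix.mulVec_smul, Matrix.mulVec_mulVec,
    Matrix.mul_nonsing_inv _ hN, Matrix.one_mulVec]

lemma eq_zero_of_add_mul_eq_zero_of_not_isSquare {K : Type*} [Field K] [CharZero K] {d : ℚ}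
    (hd : ¬IsSquare d) {s : K} (hs : s ^ 2 = d) {a b : ℚ} (h : (a : K) + b * s = 0) :
    a = 0 ∧ b = 0 := by
  have hab : a ^ 2 = d * b ^ 2 := by
    have : (a : K) ^ 2 = d * b ^ 2 := by linear_combination (a - b * s) * h + b ^ 2 * hs
    exact_mod_cast this
  have hb : b = 0 := by
    by_contra hb
    exact hd ⟨a / b, by field_simp; linear_combination -hab⟩
  subst hb
  exact ⟨by simpa using h, rfl⟩

/-- The rational matrices that map the singular points `(0 : 1 : ±√5)` and `(1 : 0 : ±i)` of the
sextic to singular points are the multiples of `diag(±1, ±1, 1)`. -/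
lemma entries_of_preserves_singular_points {M : Matrix (Fin 3) (Fin 3) ℚ} (hM : M.det ≠ 0)
    (h : ∀ x : Fin 3 → ℂ, sexticGrad x = 0 →
      sexticGrad (M.map (fun q : ℚ => (q : ℂ)) *ᵥ x) = 0) :
    M = diagonal ![M 0 0, M 1 1, M 2 2] ∧ M 0 0 ^ 2 = M 2 2 ^ 2 ∧ M 1 1 ^ 2 = M 2 2 ^ 2 := by
  rw [det_fin_three] at hM
  obtain ⟨s, hs⟩ : ∃ s : ℂ, s ^ 2 = 5 := IsAlgClosed.exists_pow_nat_eq 5 two_pos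
  have hs' : s ^ 2 = (5 : ℚ) := by simpa using hs
  have hI' : Complex.I ^ 2 = (-1 : ℚ) := by simp
  have h5 : ¬IsSquare (5 : ℚ) := by norm_num
  have h1 : ¬IsSquare (-1 : ℚ) := fun h => by linarith [h.nonneg]
  have indep5 := fun a b => eq_zero_of_add_mul_eq_zero_of_not_isSquare h5 hs' (a := a) (b := b)
  have indepI := fun a b => eq_zero_of_add_mul_eq_zero_of_not_isSquare h1 hI' (a := a) (b := b)
  have hA := singular_point_of_sexticGrad_eq_zero (h _ (sexticGrad_eq_zero_of_sq_eq_five hs))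
  have hB := singular_point_of_sexticGrad_eq_zero
    (h _ (sexticGrad_eq_zero_of_sq_eq_neg_one Complex.I_sq))
  simp only [mulVec, dotProduct, Fin.sum_univ_three, map_apply, cons_val, mul_zero, mul_one,
    zero_add, add_zero] at hA hB
  rcases hA with ⟨hA0, hA2⟩ | ⟨hA1, hA2⟩
  swap
  · obtain ⟨e1, e2⟩ := indep5 _ _ hA1
    obtain ⟨e3, -⟩ := indep5 (M 2 1 ^ 2 + 5 * M 2 2 ^ 2 + M 0 1 ^ 2 + 5 * M 0 2 ^ 2)
      (2 * M 2 1 * M 2 2 + 2 * M 0 1 * M 0 2) (by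
        push_cast
        linear_combination hA2 - (M 2 2 ^ 2 + M 0 2 ^ 2 : ℂ) * hs)
    have e4 : M 2 1 = 0 := by nlinarith
    have e5 : M 0 1 = 0 := by nlinarith
    exact absurd (by rw [e1, e4, e5]; ring) hM
  obtain ⟨m01, m02⟩ := indep5 _ _ hA0
  obtain ⟨e1, e2⟩ := indep5 (M 2 1 ^ 2 + 5 * M 2 2 ^ 2 - 5 * M 1 1 ^ 2 - 25 * M 1 2 ^ 2)
    (2 * M 2 1 * M 2 2 - 10 * M 1 1 * M 1 2) (by
      push_cast
      linear_combination hA2 - (M 2 2 ^ 2 - 5 * M 1 2 ^ 2 : ℂ) * hs)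
  rcases hB with ⟨hB0, -⟩ | ⟨hB1, hB2⟩
  · obtain ⟨m00, -⟩ := indepI _ _ hB0
    exact absurd (by rw [m00, m01, m02]; ring) hM
  obtain ⟨m10, m12⟩ := indepI _ _ hB1
  obtain ⟨e3, e4⟩ := indepI (M 2 0 ^ 2 - M 2 2 ^ 2 + M 0 0 ^ 2 - M 0 2 ^ 2)
    (2 * M 2 0 * M 2 2 + 2 * M 0 0 * M 0 2) (by
      push_cast
      linear_combination hB2 - (M 2 2 ^ 2 + M 0 2 ^ 2 : ℂ) * Complex.I_sq)
  have m22 : M 2 2 ≠ 0 := fun m22 => hM (by rw [m02, m12, m22]; ring)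
  have m21 : M 2 1 = 0 := by simpa [m12, m22] using e2
  have m20 : M 2 0 = 0 := by simpa [m02, m22] using e4
  refine ⟨?_, ?_, ?_⟩
  · ext i j
    fin_cases i <;> fin_cases j <;> simp [m01, m02, m10, m12, m20, m21]
  · rw [m20, m02] at e3
    linarith
  · rw [m21, m12] at e1
    linarith

/-- A matrix in `GL₃(ℚ)` whose induced projective linear map of `P²(ℂ)` maps the
zero locus of the sextic `F` into itself is a nonzero rational scalar multiple of
the identity or of `diag(−1,−1,1)` (the modular involution `w₅`). -/
theorem rational_linear_automorphisms_of_sexticD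
    (M : Matrix (Fin 3) (Fin 3) ℚ) (hM : IsUnit M.det)
    (hpres : ∀ x : Fin 3 → ℂ, x ≠ 0 → sexticF x = 0 →
      sexticF ((M.map (fun q : ℚ => (q : ℂ))).mulVec x) = 0) :
    ∃ q : ℚ, q ≠ 0 ∧
      (M = q • (1 : Matrix (Fin 3) (Fin 3) ℚ) ∨
       M = q • Matrix.diagonal ![-1, -1, 1]) := by
  have hdet : M.det ≠ 0 := hM.ne_zero
  have hN : IsUnit (M.map (fun q : ℚ => (q : ℂ))).det := by
    rw [isUnit_iff_ne_zero]
    have := (Rat.castHom ℂ).map_det M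
    rw [RingHom.mapMatrix_apply] at this
    exact this ▸ (map_ne_zero (Rat.castHom ℂ)).2 hdet
  obtain ⟨c, hc⟩ := sexticF_mulVec_eq_mul _ hpres
  obtain ⟨hdiag, h0, h1⟩ := entries_of_preserves_singular_points hdet
    fun x hx => sexticGrad_mulVec_eq_zero hN hc hx
  have hk : M 2 2 ≠ 0 := by
    intro hk
    rw [hdiag, det_diagonal] at hdet
    simp [Fin.prod_univ_three, hk] at hdet
  generalize M 0 0 = a at *
  generalize M 1 1 = b at *
  generalize M 2 2 = k at *
  subst hdiag
  have hab : a = b := by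
    by_contra hab
    have hba : b = -a := by
      have := sq_eq_sq_iff_eq_or_eq_neg.1 (h1.trans h0.symm)
      exact this.resolve_left (Ne.symm hab)
    have ha : a ≠ 0 := by
      rintro rfl
      simp [hba] at hab
    have key1 := hc ![1, 0, 0]
    have key2 := hc ![1, 1, 0]
    simp [sexticF, mulVec, dotProduct, Fin.sum_univ_three, diagonal_apply, hba] at key1 key2
    have : (a : ℂ) ^ 6 = 0 := by linear_combination (16 / 5 * key1 + key2) / 896
    simp [ha] at this
  subst hab
  refine ⟨k, hk, ?_⟩
  rcases sq_eq_sq_iff_eq_or_eq_neg.1 h0 with rfl | rfl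
  · left
    ext i j
    fin_cases i <;> fin_cases j <;> simp
  · right
    ext i j
    fin_cases i <;> fin_cases j <;> simp
end

section
/- Let E be the elliptic curve over ℚ given by y² + xy + y = x³ + x² − 10x − 10 (Cremona label 15A1, the curve X(b3,b5)). Then the Mordell–Weil group E(ℚ) is isomorphic to ℤ/4ℤ ⊕ ℤ/2ℤ. -/
theorem Int.exists_factorization_of_mul_eq_mul {a b c e : ℤ} (hc : c ≠ 0) (h : c * e = a * b) :
    ∃ x y z t : ℤ, c = x * y ∧ e = z * t ∧ a = x * z ∧ b = y * t ∧ IsCoprime y z := by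
  obtain ⟨y, z, hyz, hy, hz⟩ := Int.exists_gcd_one (Int.gcd_pos_of_ne_zero_left a hc)
  set x : ℤ := (Int.gcd c a : ℤ)
  rw [← Int.isCoprime_iff_gcd_eq_one] at hyz
  have hx : x ≠ 0 := by rintro h0; exact hc (by rw [hy, h0, mul_zero])
  have hy0 : y ≠ 0 := by rintro h0; exact hc (by rw [hy, h0, zero_mul])
  have h' : y * e = z * b := by
    apply mul_left_cancel₀ hx
    linear_combination h - e * hy + b * hz
  obtain ⟨t, rfl⟩ : y ∣ b := hyz.dvd_of_dvd_mul_left ⟨e, h'.symm⟩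
  refine ⟨x, y, z, t, by linarith, ?_, by linarith, rfl, hyz⟩
  apply mul_left_cancel₀ hy0
  linear_combination h'

theorem Int.exists_eq_mul_sq_of_sq_mul_eq {y z M N : ℤ} (hy : y ≠ 0) (hyz : IsCoprime y z)
    (h : z ^ 2 * M = y ^ 2 * N) : ∃ g : ℤ, M = g * y ^ 2 ∧ N = g * z ^ 2 := by
  obtain ⟨g, hg⟩ : y ^ 2 ∣ M := (hyz.pow (m := 2) (n := 2)).dvd_of_dvd_mul_left ⟨N, h⟩
  refine ⟨g, by rw [hg]; ring, ?_⟩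
  apply mul_left_cancel₀ (pow_ne_zero 2 hy)
  rw [← h, hg]; ring

theorem Int.isCoprime_two_right_of_odd {w : ℤ} (hw : Odd w) : IsCoprime w 2 := by
  obtain ⟨k, rfl⟩ := hw
  exact ⟨1, -k, by ring⟩

/-- Parametrization of primitive Pythagorean triples with odd leg `w` and even leg `2 * n`. -/
theorem Int.exists_eq_sq_sub_sq {w n q : ℤ} (hw : Odd w) (hn : n ≠ 0) (hwn : IsCoprime w n)
    (h : w ^ 2 + 4 * n ^ 2 = q ^ 2) :
    ∃ c d : ℤ, w = c ^ 2 - d ^ 2 ∧ n = c * d ∧ IsCoprime c d := by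
  have hq : 0 < |q| := by
    rw [abs_pos]; rintro rfl
    have : 0 < n ^ 2 := by positivity
    nlinarith [sq_nonneg w]
  have hpt : PythagoreanTriple w (2 * n) |q| := by
    unfold PythagoreanTriple
    rw [abs_mul_abs_self]; linarith
  obtain ⟨c, d, h1, h3, -, h4, -⟩ := hpt.coprime_classification' (Int.isCoprime_iff_gcd_eq_one.mp
    ((Int.isCoprime_two_right_of_odd hw).mul_right hwn)) (Int.odd_iff.mp hw) hq
  exact ⟨c, d, h1, by linarith, Int.isCoprime_iff_gcd_eq_one.mpr h4⟩

theorem Int.not_three_dvd_sq_add_sq {x t : ℤ} (h : IsCoprime x t) : ¬ 3 ∣ x ^ 2 + t ^ 2 := by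
  intro h3
  have key : x % 3 = 0 ∧ t % 3 = 0 := by
    have h3' : (x ^ 2 + t ^ 2) % 3 = 0 := Int.emod_eq_zero_of_dvd h3
    have hx : x % 3 = 0 ∨ x % 3 = 1 ∨ x % 3 = 2 := by omega
    have ht : t % 3 = 0 ∨ t % 3 = 1 ∨ t % 3 = 2 := by omega
    rcases hx with hx | hx | hx <;> rcases ht with ht | ht | ht <;>
      simp [pow_two, Int.add_emod, Int.mul_emod, hx, ht] at h3' ⊢
  have := h.isUnit_of_dvd' (Int.dvd_of_emod_eq_zero key.1) (Int.dvd_of_emod_eq_zero key.2)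
  norm_num [Int.isUnit_iff] at this

theorem Int.dvd_nine_of_isCoprime {x t g : ℤ} (h : IsCoprime x t) (hx : Odd x)
    (h1 : g ∣ 9 * x ^ 2) (h2 : g ∣ 144 * t ^ 2) : g ∣ 9 := by
  have hc : IsCoprime (x ^ 2) (2 ^ 4 * t ^ 2) :=
    ((Int.isCoprime_two_right_of_odd hx).pow (m := 2) (n := 4)).mul_right h.pow
  obtain ⟨u, v, huv⟩ := hc
  have : (9 : ℤ) = u * (9 * x ^ 2) + v * (144 * t ^ 2) := by linear_combination -9 * huv
  rw [this]
  exact (h1.mul_left u).add (h2.mul_left v)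

theorem Int.eq_one_or_three_or_nine_of_dvd_nine {g : ℤ} (hg : 0 < g) (h : g ∣ 9) :
    g = 1 ∨ g = 3 ∨ g = 9 := by
  have := Int.le_of_dvd (by norm_num) h
  interval_cases g <;> revert h <;> decide

theorem Int.prime_five : Prime (5 : ℤ) := by
  rw [Int.prime_iff_natAbs_prime]; norm_num

theorem Int.odd_sq_emod_eight {x : ℤ} (hx : Odd x) : x ^ 2 % 8 = 1 := by
  obtain ⟨k, rfl⟩ := hx
  obtain ⟨m, hm⟩ := Int.even_mul_succ_self k
  have : (2 * k + 1) ^ 2 = 8 * m + 1 := by linear_combination 4 * hm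
  omega

/-- The concordant equations `w² + 16 s² = □`, `w² + 25 s² = □`. -/
def Concordant (w s : ℤ) : Prop :=
  (∃ p : ℤ, w ^ 2 + 16 * s ^ 2 = p ^ 2) ∧ ∃ q : ℤ, w ^ 2 + 25 * s ^ 2 = q ^ 2

theorem abs_four_mul_lt_of_ne_zero {m t : ℤ} (h : 8 * (m * t) ≠ 0) :
    |4 * t| < |8 * (m * t)| := by
  have hm : m ≠ 0 := by rintro rfl; simp at h
  have ht : t ≠ 0 := by rintro rfl; simp at h
  have h1 : 1 ≤ |m| := Int.one_le_abs hm
  have h2 : 0 < |t| := abs_pos.mpr ht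
  rw [abs_mul, abs_mul, abs_mul]
  norm_num
  nlinarith

theorem exists_smaller_concordant {a b q : ℤ} (hodd : Odd (a ^ 2 - 16 * b ^ 2))
    (hab : IsCoprime a b) (ha0 : a ≠ 0) (hb0 : b ≠ 0)
    (hcop : IsCoprime (a ^ 2 - 16 * b ^ 2) (a * b))
    (hq : (a ^ 2 - 16 * b ^ 2) ^ 2 + 25 * (2 * (a * b)) ^ 2 = q ^ 2) :
    ∃ w s : ℤ, Odd w ∧ s ≠ 0 ∧ |s| < |2 * (a * b)| ∧ Concordant w s := by
  have ha : Odd a := by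
    by_contra hna
    rw [Int.not_odd_iff_even] at hna
    obtain ⟨k, rfl⟩ := hna
    rw [Int.odd_iff] at hodd
    ring_nf at hodd; omega
  have ha8 := Int.odd_sq_emod_eight ha
  set w := a ^ 2 - 16 * b ^ 2 with hw
  by_cases h5 : (5 : ℤ) ∣ w
  · exfalso
    obtain ⟨v, hv⟩ := h5
    obtain ⟨r, rfl⟩ : (5 : ℤ) ∣ q := by
      apply Int.prime_five.dvd_of_dvd_pow (n := 2)
      rw [← hq, hv]
      exact ⟨5 * v ^ 2 + 20 * (a * b) ^ 2, by ring⟩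
    have hvodd : Odd v := by
      rw [hv] at hodd
      exact (Int.odd_mul.mp hodd).2
    have hvc : IsCoprime v (a * b) := by
      rw [hv] at hcop
      exact hcop.of_mul_left_right
    obtain ⟨c, d, hvcd, habcd, hcd⟩ := Int.exists_eq_sq_sub_sq (q := r) hvodd
      (mul_ne_zero ha0 hb0) hvc (by rw [hv] at hq; linarith)
    have hmain : a ^ 2 - 16 * b ^ 2 = 5 * (c ^ 2 - d ^ 2) := by rw [← hw, hv, hvcd]
    have hc : Odd c ∧ d % 4 = 2 := by
      have hA : (5 * (c ^ 2 - d ^ 2)) % 8 = 1 := by rw [← hmain]; omega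
      have hc4 : c % 4 = 0 ∨ c % 4 = 1 ∨ c % 4 = 2 ∨ c % 4 = 3 := by omega
      have hd4 : d % 4 = 0 ∨ d % 4 = 1 ∨ d % 4 = 2 ∨ d % 4 = 3 := by omega
      obtain ⟨i, hi⟩ : ∃ i, c = 4 * i + c % 4 := ⟨c / 4, by omega⟩
      obtain ⟨j, hj⟩ : ∃ j, d = 4 * j + d % 4 := ⟨d / 4, by omega⟩
      rw [Int.odd_iff]
      rcases hc4 with h | h | h | h <;> rcases hd4 with h' | h' | h' | h' <;>
        rw [h] at hi <;> rw [h'] at hj <;> subst hi <;> subst hj <;> ring_nf at hA <;> omega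
    obtain ⟨hc, hd⟩ := hc
    obtain ⟨e, rfl⟩ : (2 : ℤ) ∣ d := by omega
    have he : Odd e := by rw [Int.odd_iff]; omega
    obtain ⟨f, rfl⟩ : (2 : ℤ) ∣ b :=
      (Int.isCoprime_two_right_of_odd ha).symm.dvd_of_dvd_mul_left ⟨c * e, by linarith⟩
    have hc0 : c ≠ 0 := by rintro rfl; simp at hc
    obtain ⟨x, y, z, t, rfl, rfl, rfl, rfl, hyz⟩ :=
      Int.exists_factorization_of_mul_eq_mul (a := a) (b := f) (c := c) (e := e) hc0 (by linarith)
    have hxt : IsCoprime x t := hab.of_mul_left_left.of_mul_right_right.of_mul_right_right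
    have hx := (Int.odd_mul.mp hc).1
    have hy := (Int.odd_mul.mp hc).2
    have ht := (Int.odd_mul.mp he).2
    obtain ⟨g, hg1, hg2⟩ := Int.exists_eq_mul_sq_of_sq_mul_eq (M := x ^ 2 + 20 * t ^ 2)
      (N := 5 * x ^ 2 + 64 * t ^ 2) (right_ne_zero_of_mul hc0) hyz (by linear_combination hmain)
    have hx8 := Int.odd_sq_emod_eight hx
    have hy8 := Int.odd_sq_emod_eight hy
    have ht8 := Int.odd_sq_emod_eight ht
    have hx0 : x ≠ 0 := left_ne_zero_of_mul ha0
    have hg : 0 < g := by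
      by_contra hng
      nlinarith [sq_nonneg y, sq_nonneg t, show 0 < x ^ 2 by positivity]
    have hg9 := Int.dvd_nine_of_isCoprime (g := g) hxt hx
      ⟨5 * z ^ 2 - 16 * y ^ 2, by linear_combination 5 * hg2 - 16 * hg1⟩
      ⟨4 * (5 * y ^ 2 - z ^ 2), by linear_combination 4 * (5 * hg1 - hg2)⟩
    rcases Int.eq_one_or_three_or_nine_of_dvd_nine hg hg9 with rfl | rfl | rfl <;> omega
  · have hw5 : IsCoprime w 5 := ((Int.prime_five.irreducible.coprime_iff_not_dvd).mpr h5).symm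
    obtain ⟨c, d, hwcd, habcd, hcd⟩ := Int.exists_eq_sq_sub_sq (w := w) (n := 5 * (a * b)) (q := q)
      hodd (mul_ne_zero (by norm_num) (mul_ne_zero ha0 hb0)) (hw5.mul_right hcop) (by linarith)
    have hmain : a ^ 2 - 16 * b ^ 2 = c ^ 2 - d ^ 2 := hwcd
    have hc : Odd c ∧ d % 4 = 0 := by
      have hA : (c ^ 2 - d ^ 2) % 8 = 1 := by rw [← hmain]; omega
      have hc4 : c % 4 = 0 ∨ c % 4 = 1 ∨ c % 4 = 2 ∨ c % 4 = 3 := by omega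
      have hd4 : d % 4 = 0 ∨ d % 4 = 1 ∨ d % 4 = 2 ∨ d % 4 = 3 := by omega
      obtain ⟨i, hi⟩ : ∃ i, c = 4 * i + c % 4 := ⟨c / 4, by omega⟩
      obtain ⟨j, hj⟩ : ∃ j, d = 4 * j + d % 4 := ⟨d / 4, by omega⟩
      rw [Int.odd_iff]
      rcases hc4 with h | h | h | h <;> rcases hd4 with h' | h' | h' | h' <;>
        rw [h] at hi <;> rw [h'] at hj <;> subst hi <;> subst hj <;> ring_nf at hA <;> omega
    obtain ⟨hc, hd⟩ := hc
    obtain ⟨e, rfl⟩ : (4 : ℤ) ∣ d := by omega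
    have hc0 : c ≠ 0 := by rintro rfl; simp at hc
    obtain ⟨f, rfl⟩ : (4 : ℤ) ∣ b := by
      have h1 : IsCoprime (4 : ℤ) (5 * a) := by
        have h2 : IsCoprime ((2 : ℤ) ^ 2) (5 * a) :=
          (Int.isCoprime_two_right_of_odd ((show Odd (5 : ℤ) by decide).mul ha)).symm.pow_left
        norm_num at h2; exact h2
      exact h1.dvd_of_dvd_mul_left ⟨c * e, by linarith⟩
    have hce : c * e = 5 * (a * f) := by linarith
    rcases Int.prime_five.dvd_or_dvd (show (5 : ℤ) ∣ c * e from ⟨_, hce⟩) with ⟨c', rfl⟩ | ⟨e', rfl⟩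
    · obtain ⟨x, y, z, t, rfl, rfl, rfl, rfl, hyz⟩ :=
        Int.exists_factorization_of_mul_eq_mul (a := a) (b := f) (c := c') (e := e)
          (right_ne_zero_of_mul hc0) (by linarith)
      have hxt : IsCoprime x t := hab.of_mul_left_left.of_mul_right_right.of_mul_right_right
      have hx := (Int.odd_mul.mp ha).1
      have hx0 : x ≠ 0 := left_ne_zero_of_mul ha0
      have ht0 : t ≠ 0 := right_ne_zero_of_mul (right_ne_zero_of_mul hb0)
      obtain ⟨g, hg1, hg2⟩ := Int.exists_eq_mul_sq_of_sq_mul_eq (M := x ^ 2 + 16 * t ^ 2)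
        (N := 25 * x ^ 2 + 256 * t ^ 2) (right_ne_zero_of_mul (right_ne_zero_of_mul hc0)) hyz
        (by linear_combination hmain)
      have hg : 0 < g := by
        by_contra hng
        nlinarith [sq_nonneg y, sq_nonneg t, show 0 < x ^ 2 by positivity]
      have hg9 := Int.dvd_nine_of_isCoprime (g := g) hxt hx
        ⟨z ^ 2 - 16 * y ^ 2, by linear_combination hg2 - 16 * hg1⟩
        ⟨25 * y ^ 2 - z ^ 2, by linear_combination 25 * hg1 - hg2⟩
      have h3 := Int.not_three_dvd_sq_add_sq hxt
      obtain rfl : g = 1 := by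
        rcases Int.eq_one_or_three_or_nine_of_dvd_nine hg hg9 with rfl | rfl | rfl <;> omega
      refine ⟨5 * x, 4 * t, (show Odd (5 : ℤ) by decide).mul hx, by omega, ?_,
        ⟨z, by linarith⟩, ⟨5 * y, by linarith⟩⟩
      have : 2 * (x * z * (4 * (y * t))) = 8 * (x * z * y * t) := by ring
      rw [this]
      apply abs_four_mul_lt_of_ne_zero
      rw [← this]
      exact mul_ne_zero two_ne_zero (mul_ne_zero ha0 hb0)
    · obtain ⟨x, y, z, t, rfl, rfl, rfl, rfl, hyz⟩ :=
        Int.exists_factorization_of_mul_eq_mul (a := a) (b := f) (c := c) (e := e')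
          hc0 (by linarith)
      have hxt : IsCoprime x t := hab.of_mul_left_left.of_mul_right_right.of_mul_right_right
      have hx := (Int.odd_mul.mp ha).1
      have hx0 : x ≠ 0 := left_ne_zero_of_mul ha0
      have ht0 : t ≠ 0 := right_ne_zero_of_mul (right_ne_zero_of_mul hb0)
      obtain ⟨g, hg1, hg2⟩ := Int.exists_eq_mul_sq_of_sq_mul_eq (M := x ^ 2 + 400 * t ^ 2)
        (N := x ^ 2 + 256 * t ^ 2) (right_ne_zero_of_mul hc0) hyz
        (by linear_combination hmain)
      have hg : 0 < g := by
        by_contra hng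
        nlinarith [sq_nonneg y, sq_nonneg t, show 0 < x ^ 2 by positivity]
      have hg9 := Int.dvd_nine_of_isCoprime (g := g) hxt hx
        ⟨25 * z ^ 2 - 16 * y ^ 2, by linear_combination 25 * hg2 - 16 * hg1⟩
        ⟨y ^ 2 - z ^ 2, by linear_combination hg1 - hg2⟩
      have h3 := Int.not_three_dvd_sq_add_sq hxt
      obtain rfl : g = 1 := by
        rcases Int.eq_one_or_three_or_nine_of_dvd_nine hg hg9 with rfl | rfl | rfl <;> omega
      refine ⟨x, 4 * t, hx, by omega, ?_, ⟨z, by linarith⟩, ⟨y, by linarith⟩⟩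
      have : 2 * (x * z * (4 * (y * t))) = 8 * (x * z * y * t) := by ring
      rw [this]
      apply abs_four_mul_lt_of_ne_zero
      rw [← this]
      exact mul_ne_zero two_ne_zero (mul_ne_zero ha0 hb0)

theorem Concordant.eq_zero_of_odd {w s : ℤ} (hw : Odd w) (h : Concordant w s) : s = 0 := by
  induction hn : s.natAbs using Nat.strong_induction_on generalizing w s with
  | _ n ih =>
  subst hn
  by_contra hs
  obtain ⟨⟨p, hp⟩, q, hq⟩ := h
  by_cases hcop : IsCoprime w s
  swap
  · obtain ⟨w', s', hc', hw', hs'⟩ := Int.exists_gcd_one (Int.gcd_pos_of_ne_zero_right w hs)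
    rw [Int.isCoprime_iff_gcd_eq_one] at hcop
    have hgpos := Int.gcd_pos_of_ne_zero_right w hs
    have hg0 : (Int.gcd w s : ℤ) ≠ 0 := by exact_mod_cast hgpos.ne'
    have hg1 : 1 < Int.gcd w s := by omega
    generalize Int.gcd w s = g at hw' hs' hg0 hg1
    subst hw' hs'
    have hs0 : s' ≠ 0 := left_ne_zero_of_mul hs
    obtain ⟨p', rfl⟩ : (g : ℤ) ∣ p :=
      (Int.pow_dvd_pow_iff two_ne_zero).mp ⟨w' ^ 2 + 16 * s' ^ 2, by rw [← hp]; ring⟩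
    obtain ⟨q', rfl⟩ : (g : ℤ) ∣ q :=
      (Int.pow_dvd_pow_iff two_ne_zero).mp ⟨w' ^ 2 + 25 * s' ^ 2, by rw [← hq]; ring⟩
    have hg2 : (g : ℤ) ^ 2 ≠ 0 := pow_ne_zero 2 hg0
    refine hs0 (ih s'.natAbs ?_ (Int.odd_mul.mp hw).1 ⟨⟨p', ?_⟩, q', ?_⟩ rfl)
    · rw [Int.natAbs_mul, Int.natAbs_natCast]
      have := Int.natAbs_pos.mpr hs0
      nlinarith
    · apply mul_left_cancel₀ hg2; linear_combination hp
    · apply mul_left_cancel₀ hg2; linear_combination hq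
  have hw8 := Int.odd_sq_emod_eight hw
  have hs2 : (2 : ℤ) ∣ s := by
    by_contra hs2
    have hs8 := Int.odd_sq_emod_eight (Int.odd_iff.mpr (show s % 2 = 1 by omega))
    have hq8 : q ^ 2 % 8 = 2 := by omega
    rcases Int.even_or_odd q with hq2 | hq2
    · obtain ⟨r, rfl⟩ := hq2
      ring_nf at hq8; omega
    · have := Int.odd_sq_emod_eight hq2; omega
  obtain ⟨k, rfl⟩ := hs2
  have hk : k ≠ 0 := right_ne_zero_of_mul hs
  have hw2 := Int.isCoprime_two_right_of_odd hw
  have hwk : IsCoprime w k := hcop.of_mul_right_right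
  obtain ⟨m, n, hmn, hkmn, hmnc⟩ := Int.exists_eq_sq_sub_sq (n := 2 * 2 * k) (q := p) hw
    (mul_ne_zero (by norm_num) hk) ((hw2.mul_right hw2).mul_right hwk) (by linarith)
  have key : ∃ a b : ℤ, k = a * b ∧ IsCoprime a b ∧
      (w = a ^ 2 - 16 * b ^ 2 ∨ -w = a ^ 2 - 16 * b ^ 2) := by
    have h4 : ∀ {i : ℤ}, Odd i → IsCoprime (2 * 2) i := fun hi =>
      ((Int.isCoprime_two_right_of_odd hi).symm.mul_left (Int.isCoprime_two_right_of_odd hi).symm)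
    rcases Int.even_or_odd m with hm | hm
    · have hnodd : Odd n := by
        rcases Int.even_or_odd n with hn | hn
        · have := hmnc.isUnit_of_dvd' hm.two_dvd hn.two_dvd
          norm_num [Int.isUnit_iff] at this
        · exact hn
      obtain ⟨b, rfl⟩ := (h4 hnodd).dvd_of_dvd_mul_right (Dvd.intro k hkmn)
      exact ⟨n, b, by linarith, hmnc.of_mul_left_right.symm, Or.inr (by rw [hmn]; ring)⟩
    · obtain ⟨b, rfl⟩ := (h4 hm).dvd_of_dvd_mul_left (Dvd.intro k hkmn)
      exact ⟨m, b, by linarith, hmnc.of_mul_right_right, Or.inl (by rw [hmn]; ring)⟩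
  obtain ⟨a, b, rfl, hab, hwab⟩ := key
  have ha0 : a ≠ 0 := left_ne_zero_of_mul hk
  have hb0 : b ≠ 0 := right_ne_zero_of_mul hk
  obtain ⟨w', s', hw', hs', hlt, hconc⟩ : ∃ w s : ℤ, Odd w ∧ s ≠ 0 ∧ |s| < |2 * (a * b)| ∧
      Concordant w s := by
    rcases hwab with rfl | hwab
    · exact exists_smaller_concordant hw hab ha0 hb0 hwk hq
    · exact exists_smaller_concordant (hwab ▸ hw.neg) hab ha0 hb0 (hwab ▸ hwk.neg_left) (q := q)
        (by rw [← hwab]; linarith)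
  exact hs' (ih s'.natAbs (by zify; exact hlt) hw' hconc rfl)

/-- The numbers `16` and `25` are not concordant. -/
theorem Concordant.eq_zero_or_eq_zero {w s : ℤ} (h : Concordant w s) (hcop : IsCoprime w s) :
    w = 0 ∨ s = 0 := by
  rcases Int.even_or_odd w with hw | hw
  swap
  · exact Or.inr (h.eq_zero_of_odd hw)
  left
  have hs : Odd s := by
    rcases Int.even_or_odd s with hs | hs
    · have := hcop.isUnit_of_dvd' hw.two_dvd hs.two_dvd
      norm_num [Int.isUnit_iff] at this
    · exact hs
  obtain ⟨⟨p, hp⟩, q, hq⟩ := h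
  have hs8 := Int.odd_sq_emod_eight hs
  have hw4 : (4 : ℤ) ∣ w := by
    obtain ⟨v, rfl⟩ := hw.two_dvd
    have hq2 : Odd q := by
      by_contra hq2
      obtain ⟨r, rfl⟩ := (Int.not_odd_iff_even.mp hq2).two_dvd
      ring_nf at hq; omega
    have hq8 := Int.odd_sq_emod_eight hq2
    rcases Int.even_or_odd v with hv | hv
    · obtain ⟨u, rfl⟩ := hv.two_dvd
      exact ⟨u, by ring⟩
    · have := Int.odd_sq_emod_eight hv
      ring_nf at hq; omega
  obtain ⟨v, rfl⟩ := hw4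
  obtain ⟨r, rfl⟩ : (4 : ℤ) ∣ p :=
    (Int.pow_dvd_pow_iff two_ne_zero).mp ⟨v ^ 2 + s ^ 2, by rw [← hp]; ring⟩
  have : v = 0 := Concordant.eq_zero_of_odd (w := 5 * s) ((show Odd (5 : ℤ) by decide).mul hs)
    ⟨⟨q, by linarith⟩, 5 * r, by linarith⟩
  rw [this, mul_zero]

theorem Rat.eq_zero_of_sq_add_eq_sq {r p q : ℚ} (hp : r ^ 2 + 16 = p ^ 2)
    (hq : r ^ 2 + 25 = q ^ 2) : r = 0 := by
  have hden : (r.den : ℚ) ≠ 0 := by exact_mod_cast r.den_ne_zero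
  have hr : (r.num : ℚ) = r * r.den := (Rat.mul_den_eq_num r).symm
  have hsq : ∀ {n : ℤ} {p : ℚ}, r ^ 2 + n = p ^ 2 →
      ∃ m : ℤ, r.num ^ 2 + n * (r.den : ℤ) ^ 2 = m ^ 2 := by
    intro n p h
    obtain ⟨m, hm⟩ := Rat.isSquare_intCast_iff (z := r.num ^ 2 + n * (r.den : ℤ) ^ 2) |>.mp
      ⟨p * r.den, by push_cast; rw [hr]; linear_combination (r.den : ℚ) ^ 2 * h⟩
    exact ⟨m, by rw [hm, sq]⟩
  have hconc : Concordant r.num r.den :=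
    ⟨hsq (n := 16) (by exact_mod_cast hp), hsq (n := 25) (by exact_mod_cast hq)⟩
  rcases hconc.eq_zero_or_eq_zero (Rat.isCoprime_num_den r) with h | h
  · exact Rat.num_eq_zero.mp h
  · exact absurd h (by exact_mod_cast r.den_ne_zero)

theorem eq_of_sq_eq_mul_add_nine_mul_sub_sixteen {u v : ℚ}
    (h : v ^ 2 = u * (u + 9) * (u - 16)) : v = 0 ∨ u = 36 ∨ u = -4 := by
  by_cases hv : v = 0
  · exact Or.inl hv
  right
  have h0 : (u ^ 2 - 32 * u - 144) / (2 * v) = 0 := by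
    apply Rat.eq_zero_of_sq_add_eq_sq (p := (u ^ 2 + 144) / (2 * v))
      (q := (u ^ 2 + 18 * u - 144) / (2 * v))
    · field_simp; linear_combination 64 * h
    · field_simp; linear_combination 100 * h
  have h1 : u ^ 2 - 32 * u - 144 = 0 := by simpa [hv] using h0
  have h2 : (u - 36) * (u + 4) = 0 := by linear_combination h1
  rcases mul_eq_zero.mp h2 with h3 | h3
  · exact Or.inl (by linarith)
  · exact Or.inr (by linarith)

/-- The elliptic curve `15A1`. -/
abbrev curve15A1 : WeierstrassCurve ℚ := ⟨1, 1, 1, -10, -10⟩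

namespace curve15A1

open WeierstrassCurve.Affine

theorem equation_iff {x y : ℚ} : curve15A1.toAffine.Equation x y ↔
    y ^ 2 + x * y + y = x ^ 3 + x ^ 2 - 10 * x - 10 := by
  rw [WeierstrassCurve.Affine.equation_iff]
  constructor <;> intro h <;> linear_combination h

theorem discriminant_ne_zero : curve15A1.Δ ≠ 0 := by
  norm_num [WeierstrassCurve.Δ, WeierstrassCurve.b₂, WeierstrassCurve.b₄, WeierstrassCurve.b₆,
    WeierstrassCurve.b₈]

theorem nonsingular {x y : ℚ} (h : y ^ 2 + x * y + y = x ^ 3 + x ^ 2 - 10 * x - 10) :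
    curve15A1.toAffine.Nonsingular x y :=
  (equation_iff_nonsingular_of_Δ_ne_zero discriminant_ne_zero).mp (equation_iff.mpr h)

/-- The affine point `(x, y)` of `15A1`. -/
def affinePoint (x y : ℚ) (h : y ^ 2 + x * y + y = x ^ 3 + x ^ 2 - 10 * x - 10) :
    curve15A1.toAffine.Point :=
  .some x y (nonsingular h)

theorem coordinates_of_equation {x y : ℚ}
    (h : y ^ 2 + x * y + y = x ^ 3 + x ^ 2 - 10 * x - 10) :
    (x = -1 ∧ y = 0) ∨ (x = 3 ∧ y = -2) ∨ (x = -13 / 4 ∧ y = 9 / 8) ∨ (x = 8 ∧ y = 18) ∨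
      (x = 8 ∧ y = -27) ∨ (x = -2 ∧ y = 3) ∨ (x = -2 ∧ y = -2) := by
  rcases eq_of_sq_eq_mul_add_nine_mul_sub_sixteen (u := 4 * x + 4) (v := 4 * (2 * y + x + 1))
    (by linear_combination 64 * h) with hv | hu | hu
  · have hy : y = -(x + 1) / 2 := by linarith
    have hx : (x + 1) * ((x - 3) * (4 * x + 13)) = 0 := by
      rw [hy] at h; linear_combination -4 * h
    rcases mul_eq_zero.mp hx with h1 | h1
    · obtain rfl : x = -1 := by linarith
      norm_num [hy]
    rcases mul_eq_zero.mp h1 with h2 | h2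
    · obtain rfl : x = 3 := by linarith
      norm_num [hy]
    · obtain rfl : x = -13 / 4 := by linarith
      norm_num [hy]
  · obtain rfl : x = 8 := by linarith
    have hy : (y - 18) * (y + 27) = 0 := by linear_combination h
    rcases mul_eq_zero.mp hy with h1 | h1
    · obtain rfl : y = 18 := by linarith
      norm_num
    · obtain rfl : y = -27 := by linarith
      norm_num
  · obtain rfl : x = -2 := by linarith
    have hy : (y - 3) * (y + 2) = 0 := by linear_combination h
    rcases mul_eq_zero.mp hy with h1 | h1
    · obtain rfl : y = 3 := by linarith
      norm_num
    · obtain rfl : y = -2 := by linarith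
      norm_num

/-- A rational point of order four. -/
def P : curve15A1.toAffine.Point := affinePoint 8 18 (by norm_num)

/-- A rational point of order two outside the subgroup generated by `P`. -/
def T : curve15A1.toAffine.Point := affinePoint (-1) 0 (by norm_num)

theorem two_nsmul_P : 2 • P = affinePoint 3 (-2) (by norm_num) := by
  have hy : (18 : ℚ) ≠ curve15A1.toAffine.negY 8 18 := by norm_num [negY]
  rw [two_nsmul, P, affinePoint, Point.add_self_of_Y_ne hy, affinePoint, Point.some.injEq,
    slope_of_Y_ne rfl hy]
  norm_num [addX, addY, negAddY, negY]

theorem four_nsmul_P : 4 • P = 0 := by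
  rw [show 4 = 2 * 2 from rfl, mul_nsmul, two_nsmul_P, two_nsmul, affinePoint]
  exact Point.add_self_of_Y_eq (by norm_num [negY])

theorem two_nsmul_T : 2 • T = 0 := by
  rw [two_nsmul, T, affinePoint]
  exact Point.add_self_of_Y_eq (by norm_num [negY])

theorem three_nsmul_P : 3 • P = affinePoint 8 (-27) (by norm_num) := by
  have h : 3 • P + P = 0 := by rw [← succ_nsmul, four_nsmul_P]
  rw [eq_neg_of_add_eq_zero_left h, P, affinePoint, Point.neg_some, affinePoint, Point.some.injEq]
  norm_num [negY]

theorem P_add_T : P + T = affinePoint (-2) 3 (by norm_num) := by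
  have hx : (8 : ℚ) ≠ -1 := by norm_num
  rw [P, T, affinePoint, affinePoint, Point.add_of_X_ne hx, affinePoint, Point.some.injEq,
    slope_of_X_ne hx]
  norm_num [addX, addY, negAddY, negY]

theorem two_nsmul_P_add_T : 2 • P + T = affinePoint (-13 / 4) (9 / 8) (by norm_num) := by
  have hx : (3 : ℚ) ≠ -1 := by norm_num
  rw [two_nsmul_P, T, affinePoint, affinePoint, Point.add_of_X_ne hx, affinePoint,
    Point.some.injEq, slope_of_X_ne hx]
  norm_num [addX, addY, negAddY, negY]

theorem three_nsmul_P_add_T : 3 • P + T = affinePoint (-2) (-2) (by norm_num) := by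
  have hx : (8 : ℚ) ≠ -1 := by norm_num
  rw [three_nsmul_P, T, affinePoint, affinePoint, Point.add_of_X_ne hx, affinePoint,
    Point.some.injEq, slope_of_X_ne hx]
  norm_num [addX, addY, negAddY, negY]

/-- The homomorphism `(i, j) ↦ i • P + j • T`. -/
noncomputable def torsionHom : ZMod 4 × ZMod 2 →+ curve15A1.toAffine.Point :=
  (ZMod.lift 4 ⟨zmultiplesHom _ P, (natCast_zsmul P 4).trans four_nsmul_P⟩).coprod
    (ZMod.lift 2 ⟨zmultiplesHom _ T, (natCast_zsmul T 2).trans two_nsmul_T⟩)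

theorem torsionHom_natCast (i j : ℕ) : torsionHom (i, j) = i • P + j • T := by
  have h4 := ZMod.lift_coe 4 ⟨zmultiplesHom _ P, (natCast_zsmul P 4).trans four_nsmul_P⟩ (i : ℤ)
  have h2 := ZMod.lift_coe 2 ⟨zmultiplesHom _ T, (natCast_zsmul T 2).trans two_nsmul_T⟩ (j : ℤ)
  push_cast at h4 h2
  rw [torsionHom, AddMonoidHom.coprod_apply, h4, h2]
  simp

theorem torsionHom_injective : Function.Injective torsionHom := by
  rw [injective_iff_map_eq_zero]
  rintro ⟨i, j⟩ h
  rw [← ZMod.natCast_zmod_val i, ← ZMod.natCast_zmod_val j, torsionHom_natCast] at h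
  have ne_zero {x y : ℚ} (hxy) : affinePoint x y hxy ≠ 0 := Point.some_ne_zero _
  have hi : i.val = 0 ∨ i.val = 1 ∨ i.val = 2 ∨ i.val = 3 := by have := i.val_lt; omega
  have hj : j.val = 0 ∨ j.val = 1 := by have := j.val_lt; omega
  rcases hi with hi | hi | hi | hi <;> rcases hj with hj | hj <;> rw [hi, hj] at h
  · rw [(ZMod.val_eq_zero i).mp hi, (ZMod.val_eq_zero j).mp hj]; rfl
  all_goals exfalso
  · rw [zero_nsmul, zero_add, one_nsmul] at h; exact ne_zero _ h
  · rw [zero_nsmul, add_zero, one_nsmul] at h; exact ne_zero _ h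
  · rw [one_nsmul, one_nsmul, P_add_T] at h; exact ne_zero _ h
  · rw [zero_nsmul, add_zero, two_nsmul_P] at h; exact ne_zero _ h
  · rw [one_nsmul, two_nsmul_P_add_T] at h; exact ne_zero _ h
  · rw [zero_nsmul, add_zero, three_nsmul_P] at h; exact ne_zero _ h
  · rw [one_nsmul, three_nsmul_P_add_T] at h; exact ne_zero _ h

theorem torsionHom_surjective : Function.Surjective torsionHom := by
  rintro (_ | ⟨x, y, h⟩)
  · exact ⟨0, map_zero _⟩
  rcases coordinates_of_equation (equation_iff.mp h.1) with
    ⟨rfl, rfl⟩ | ⟨rfl, rfl⟩ | ⟨rfl, rfl⟩ | ⟨rfl, rfl⟩ | ⟨rfl, rfl⟩ | ⟨rfl, rfl⟩ | ⟨rfl, rfl⟩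
  · exact ⟨((0 : ℕ), (1 : ℕ)), by rw [torsionHom_natCast, zero_nsmul, zero_add, one_nsmul]; rfl⟩
  · exact ⟨((2 : ℕ), (0 : ℕ)), by
      rw [torsionHom_natCast, zero_nsmul, add_zero, two_nsmul_P]; rfl⟩
  · exact ⟨((2 : ℕ), (1 : ℕ)), by rw [torsionHom_natCast, one_nsmul, two_nsmul_P_add_T]; rfl⟩
  · exact ⟨((1 : ℕ), (0 : ℕ)), by rw [torsionHom_natCast, zero_nsmul, add_zero, one_nsmul]; rfl⟩
  · exact ⟨((3 : ℕ), (0 : ℕ)), by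
      rw [torsionHom_natCast, zero_nsmul, add_zero, three_nsmul_P]; rfl⟩
  · exact ⟨((1 : ℕ), (1 : ℕ)), by rw [torsionHom_natCast, one_nsmul, one_nsmul, P_add_T]; rfl⟩
  · exact ⟨((3 : ℕ), (1 : ℕ)), by rw [torsionHom_natCast, one_nsmul, three_nsmul_P_add_T]; rfl⟩

end curve15A1

/-- The Mordell–Weil group of the elliptic curve
`15A1 : y² + xy + y = x³ + x² − 10x − 10` (the modular curve `X(b3,b5)`) over `ℚ`
is `ℤ/4ℤ ⊕ ℤ/2ℤ`. -/
theorem mordell_weil_15A1_over_Q :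
    let W : WeierstrassCurve ℚ := ⟨1, 1, 1, -10, -10⟩
    Nonempty (W.toAffine.Point ≃+ (ZMod 4 × ZMod 2)) :=
  ⟨(AddEquiv.ofBijective curve15A1.torsionHom
    ⟨curve15A1.torsionHom_injective, curve15A1.torsionHom_surjective⟩).symm⟩
end

section
/- The homogeneous sextic polynomial 5u⁶ − 50u⁵v + 206u⁴v² − 408u³v³ + 321u²v⁴ + 10uv⁵ − 100v⁶ + 9u⁴w² − 60u³vw² + 80u²v²w² + 48uv³w² + 15v⁴w² + 3u²w⁴ − 10uvw⁴ + 6v²w⁴ − w⁶ is irreducible in the polynomial ring ℂ[u, v, w]; that is, the plane sextic model D of the modular curve X(b5,ns7) is geometrically irreducible. -/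
namespace Polynomial

/-- If `f` is monic irreducible of odd degree over a field and `-f(0)` is not a square, then
`f(X ^ 2)` is irreducible. -/
lemma irreducible_comp_X_sq_of_field {K : Type*} [Field K] {f : K[X]} (hf : f.Monic)
    (hirr : Irreducible f) (hodd : Odd f.natDegree) (hsq : ¬ IsSquare (-f.coeff 0)) :
    Irreducible (f.comp (X ^ 2)) := by
  refine irreducible_comp hf (monic_X_pow 2) hirr fun E _ _ x hx ↦ ?_
  rw [Polynomial.map_pow, map_X]
  have hint : IsIntegral K x := minpoly.ne_zero_iff.mp (hx ▸ hf.ne_zero)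
  refine X_pow_sub_C_irreducible_of_prime Nat.prime_two fun b hb ↦ hsq ⟨Algebra.norm K b, ?_⟩
  rw [← pow_two, ← map_pow, hb, ← IntermediateField.adjoin.powerBasis_gen hint,
    Algebra.PowerBasis.norm_gen_eq_coeff_zero_minpoly]
  simp [IntermediateField.minpoly_gen, hx, hodd.neg_one_pow]

/-- If `f` is monic irreducible of odd degree over an integrally closed domain and `-f(0)` is not a
square, then `f(X ^ 2)` is irreducible. -/
lemma irreducible_comp_X_sq {R : Type*} [CommRing R] [IsDomain R] [IsIntegrallyClosed R] {f : R[X]}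
    (hf : f.Monic) (hirr : Irreducible f) (hodd : Odd f.natDegree)
    (hsq : ¬ IsSquare (-f.coeff 0)) : Irreducible (f.comp (X ^ 2)) := by
  have hcomp : (f.comp (X ^ 2)).Monic := hf.comp (monic_X_pow 2) (by simp)
  rw [hcomp.irreducible_iff_irreducible_map_fraction_map (K := FractionRing R), map_comp,
    Polynomial.map_pow, map_X]
  refine irreducible_comp_X_sq_of_field (hf.map _)
    (hf.irreducible_iff_irreducible_map_fraction_map.mp hirr) (by rwa [hf.natDegree_map]) ?_
  rintro ⟨y, hy⟩
  rw [coeff_map, ← map_neg, ← pow_two] at hy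
  obtain ⟨z, rfl⟩ := IsIntegrallyClosed.exists_algebraMap_eq_of_isIntegral_pow
    (R := R) (K := FractionRing R) two_pos (hy ▸ isIntegral_algebraMap)
  refine hsq ⟨z, IsFractionRing.injective R (FractionRing R) ?_⟩
  rw [hy, pow_two, map_mul]

end Polynomial

namespace SexticD

open Polynomial

/-- The coefficient of `w ^ 4` in the sextic, on the chart `u = 1`, `v = X`. -/
noncomputable def quarticCoeff : ℂ[X] := 3 - 10 * X + 6 * X ^ 2

/-- The coefficient of `w ^ 2` in the sextic, on the chart `u = 1`, `v = X`. -/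
noncomputable def quadraticCoeff : ℂ[X] := 9 - 60 * X + 80 * X ^ 2 + 48 * X ^ 3 + 15 * X ^ 4

/-- The part of the sextic free of `w`, on the chart `u = 1`, `v = X`. -/
noncomputable def constantCoeff : ℂ[X] :=
  5 - 50 * X + 206 * X ^ 2 - 408 * X ^ 3 + 321 * X ^ 4 + 10 * X ^ 5 - 100 * X ^ 6

/-- The negative of the sextic on the chart `u = 1`, `v = X`, as a cubic in `w ^ 2`. -/
noncomputable def cubic : ℂ[X][X] :=
  X ^ 3 - C quarticCoeff * X ^ 2 - C quadraticCoeff * X - C constantCoeff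

lemma natDegree_quarticCoeff_le : quarticCoeff.natDegree ≤ 2 := by
  unfold quarticCoeff; compute_degree

lemma natDegree_quadraticCoeff_le : quadraticCoeff.natDegree ≤ 4 := by
  unfold quadraticCoeff; compute_degree

lemma natDegree_constantCoeff_le : constantCoeff.natDegree ≤ 6 := by
  unfold constantCoeff; compute_degree

lemma natDegree_cubic : cubic.natDegree = 3 := by
  unfold cubic; compute_degree!

lemma monic_cubic : cubic.Monic := by
  unfold cubic; monicity!

lemma coeffs_eq_zero_of_sextic_eq_zero {R : Type*} [CommRing R] {e₀ e₁ e₂ e₃ e₄ e₅ e₆ : R}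
    (h : C e₀ + C e₁ * X + C e₂ * X ^ 2 + C e₃ * X ^ 3 + C e₄ * X ^ 4 + C e₅ * X ^ 5
      + C e₆ * X ^ 6 = 0) :
    e₀ = 0 ∧ e₁ = 0 ∧ e₂ = 0 ∧ e₃ = 0 ∧ e₄ = 0 ∧ e₅ = 0 ∧ e₆ = 0 := by
  refine ⟨?_, ?_, ?_, ?_, ?_, ?_, ?_⟩
  · simpa [coeff_X, coeff_C] using congrArg (coeff · 0) h
  · simpa [coeff_X, coeff_C] using congrArg (coeff · 1) h
  · simpa [coeff_X, coeff_C] using congrArg (coeff · 2) h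
  · simpa [coeff_X, coeff_C] using congrArg (coeff · 3) h
  · simpa [coeff_X, coeff_C] using congrArg (coeff · 4) h
  · simpa [coeff_X, coeff_C] using congrArg (coeff · 5) h
  · simpa [coeff_X, coeff_C] using congrArg (coeff · 6) h

lemma not_isSquare_constantCoeff : ¬ IsSquare constantCoeff := by
  rintro ⟨s, hs⟩
  have hdeg : s.natDegree < 4 := by
    have h := natDegree_constantCoeff_le
    rw [hs, ← pow_two, natDegree_pow] at h
    lia
  rw [s.as_sum_range_C_mul_X_pow' hdeg] at hs
  simp only [Finset.sum_range_succ, Finset.sum_range_zero, zero_add] at hs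
  generalize s.coeff 0 = a, s.coeff 1 = b, s.coeff 2 = c, s.coeff 3 = d at hs
  obtain ⟨h₀, h₁, h₂, h₃, -, h₅, -⟩ := coeffs_eq_zero_of_sextic_eq_zero
    (e₀ := a ^ 2 - 5) (e₁ := 2 * a * b + 50) (e₂ := b ^ 2 + 2 * a * c - 206)
    (e₃ := 2 * a * d + 2 * b * c + 408) (e₄ := c ^ 2 + 2 * b * d - 321)
    (e₅ := 2 * c * d - 10) (e₆ := d ^ 2 + 100) (by
      simp only [map_add, map_sub, map_mul, map_pow, map_ofNat]
      unfold constantCoeff at hs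
      linear_combination -hs)
  obtain rfl : b = -5 * a := by linear_combination a / 10 * h₁ - b / 5 * h₀
  obtain rfl : c = 81 / 10 * a := by linear_combination a / 10 * h₂ - (c / 5 + 5 / 2 * a) * h₀
  obtain rfl : d = -3 / 10 * a := by
    linear_combination a / 10 * h₃ + (81 / 10 * a - d / 5) * h₀
  have : (343 / 10 : ℂ) = 0 := by linear_combination -h₅ - 243 / 50 * h₀
  norm_num at this

lemma natDegree_le_of_isRoot_cubic {r : ℂ[X]} (hr : cubic.IsRoot r) : r.natDegree ≤ 2 := by
  have h : r ^ 3 = quarticCoeff * r ^ 2 + quadraticCoeff * r + constantCoeff := by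
    have := hr.eq_zero
    simp only [cubic, eval_sub, eval_mul, eval_pow, eval_X, eval_C] at this
    linear_combination this
  by_contra! hlt
  have hle : (r ^ 3).natDegree ≤ 2 + 2 * r.natDegree := by
    rw [h]
    refine natDegree_add_le_of_degree_le (natDegree_add_le_of_degree_le ?_ ?_) ?_
    · exact natDegree_mul_le_of_le natDegree_quarticCoeff_le (natDegree_pow_le)
    · exact (natDegree_mul_le_of_le natDegree_quadraticCoeff_le le_rfl).trans (by lia)
    · exact natDegree_constantCoeff_le.trans (by lia)
  rw [natDegree_pow] at hle
  lia

lemma not_isRoot_cubic (r : ℂ[X]) : ¬ cubic.IsRoot r := by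
  intro hr
  have hdeg : r.natDegree < 3 := Nat.lt_succ_of_le (natDegree_le_of_isRoot_cubic hr)
  have h := hr.eq_zero
  simp only [cubic, eval_sub, eval_mul, eval_pow, eval_X, eval_C] at h
  rw [r.as_sum_range_C_mul_X_pow' hdeg] at h
  simp only [Finset.sum_range_succ, Finset.sum_range_zero, zero_add] at h
  generalize r.coeff 0 = a, r.coeff 1 = b, r.coeff 2 = c at h
  obtain ⟨h₀, h₁, h₂, -, h₄, h₅, h₆⟩ := coeffs_eq_zero_of_sextic_eq_zero
    (e₀ := a ^ 3 - 3 * a ^ 2 - 9 * a - 5)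
    (e₁ := 3 * a ^ 2 * b - (6 * a * b - 10 * a ^ 2) - (9 * b - 60 * a) + 50)
    (e₂ := 3 * a ^ 2 * c + 3 * a * b ^ 2 - (3 * (b ^ 2 + 2 * a * c) - 20 * a * b + 6 * a ^ 2)
      - (9 * c - 60 * b + 80 * a) - 206)
    (e₃ := 6 * a * b * c + b ^ 3 - (6 * b * c - 10 * (b ^ 2 + 2 * a * c) + 12 * a * b)
      - (-60 * c + 80 * b + 48 * a) + 408)
    (e₄ := 3 * a * c ^ 2 + 3 * b ^ 2 * c - (3 * c ^ 2 - 20 * b * c + 6 * (b ^ 2 + 2 * a * c))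
      - (80 * c + 48 * b + 15 * a) - 321)
    (e₅ := 3 * b * c ^ 2 - (-10 * c ^ 2 + 12 * b * c) - (48 * c + 15 * b) - 10)
    (e₆ := c ^ 3 - 6 * c ^ 2 - 15 * c + 100) (by
      simp only [map_add, map_sub, map_mul, map_pow, map_neg, map_ofNat]
      unfold quarticCoeff quadraticCoeff constantCoeff at h
      linear_combination h)
  have ha : a = -1 ∨ a = 5 := by
    have : (a + 1) ^ 2 * (a - 5) = 0 := by linear_combination h₀
    simpa [sub_eq_zero, add_eq_zero_iff_eq_neg] using this
  have hc : c = 5 ∨ c = -4 := by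
    have : (c - 5) ^ 2 * (c + 4) = 0 := by linear_combination h₆
    simpa [sub_eq_zero, add_eq_zero_iff_eq_neg] using this
  rcases ha with rfl | rfl
  · rcases hc with rfl | rfl
    · obtain rfl : b = 71 / 8 := by linear_combination (2 * h₄ + 3 * h₂) / 224
      norm_num at h₂
    · obtain rfl : b = -38 / 9 := by linear_combination h₅ / 81
      norm_num at h₂
  · obtain rfl : b = -50 / 3 := by linear_combination h₁ / 36
    rcases hc with rfl | rfl <;> norm_num at h₂

lemma irreducible_cubic : Irreducible cubic := by
  rw [monic_cubic.irreducible_iff_roots_eq_zero_of_degree_le_three (by simp [natDegree_cubic])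
    natDegree_cubic.le]
  exact Multiset.eq_zero_of_forall_notMem fun r hr ↦ not_isRoot_cubic r (isRoot_of_mem_roots hr)

lemma irreducible_cubic_comp_X_sq : Irreducible (cubic.comp (X ^ 2)) := by
  refine irreducible_comp_X_sq monic_cubic irreducible_cubic ?_ ?_
  · rw [natDegree_cubic]; decide
  · simpa [cubic] using not_isSquare_constantCoeff

end SexticD

open MvPolynomial

/-- The homogeneous sextic defining the plane model `D` of `X(b5,ns7)` is
irreducible in `ℂ[u, v, w]`; i.e. the curve `D` is geometrically irreducible.
Here `u = X 0`, `v = X 1`, `w = X 2`. -/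
theorem sexticD_geometrically_irreducible :
    Irreducible
      (5 * X 0 ^ 6 - 50 * X 0 ^ 5 * X 1 + 206 * X 0 ^ 4 * X 1 ^ 2 - 408 * X 0 ^ 3 * X 1 ^ 3
        + 321 * X 0 ^ 2 * X 1 ^ 4 + 10 * X 0 * X 1 ^ 5 - 100 * X 1 ^ 6
        + 9 * X 0 ^ 4 * X 2 ^ 2 - 60 * X 0 ^ 3 * X 1 * X 2 ^ 2
        + 80 * X 0 ^ 2 * X 1 ^ 2 * X 2 ^ 2 + 48 * X 0 * X 1 ^ 3 * X 2 ^ 2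
        + 15 * X 1 ^ 4 * X 2 ^ 2 + 3 * X 0 ^ 2 * X 2 ^ 4 - 10 * X 0 * X 1 * X 2 ^ 4
        + 6 * X 1 ^ 2 * X 2 ^ 4 - X 2 ^ 6 : MvPolynomial (Fin 3) ℂ) := by
  let φ : MvPolynomial (Fin 2) ℂ →+* Polynomial ℂ := (aeval ![Polynomial.X, 1]).toRingHom
  let e := (renameEquiv ℂ (Equiv.swap (0 : Fin 3) 2)).trans (finSuccEquiv ℂ 2)
  have hX0 : e (X 0) = Polynomial.C (X 1) := by
    simpa [e] using finSuccEquiv_X_succ (R := ℂ) (n := 2) (j := 1)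
  have hX1 : e (X 1) = Polynomial.C (X 0) := by
    have hswap : Equiv.swap (0 : Fin 3) 2 1 = 1 := by decide
    simpa [e, hswap] using finSuccEquiv_X_succ (R := ℂ) (n := 2) (j := 0)
  have hX2 : e (X 2) = Polynomial.X := by
    simpa [e] using finSuccEquiv_X_zero (R := ℂ) (n := 2)
  let a₂ : MvPolynomial (Fin 2) ℂ := 3 * X 1 ^ 2 - 10 * X 1 * X 0 + 6 * X 0 ^ 2
  let a₄ : MvPolynomial (Fin 2) ℂ := 9 * X 1 ^ 4 - 60 * X 1 ^ 3 * X 0 + 80 * X 1 ^ 2 * X 0 ^ 2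
    + 48 * X 1 * X 0 ^ 3 + 15 * X 0 ^ 4
  let a₆ : MvPolynomial (Fin 2) ℂ := 5 * X 1 ^ 6 - 50 * X 1 ^ 5 * X 0 + 206 * X 1 ^ 4 * X 0 ^ 2
    - 408 * X 1 ^ 3 * X 0 ^ 3 + 321 * X 1 ^ 2 * X 0 ^ 4 + 10 * X 1 * X 0 ^ 5 - 100 * X 0 ^ 6
  let p : Polynomial (MvPolynomial (Fin 2) ℂ) := Polynomial.X ^ 6
    - Polynomial.C a₂ * Polynomial.X ^ 4 - Polynomial.C a₄ * Polynomial.X ^ 2 - Polynomial.C a₆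
  have hp : Irreducible p := by
    refine Polynomial.Monic.irreducible_of_irreducible_map φ _ (by unfold p; monicity!) ?_
    convert SexticD.irreducible_cubic_comp_X_sq using 1
    have h₂ : φ a₂ = SexticD.quarticCoeff := by simp [φ, a₂, SexticD.quarticCoeff]
    have h₄ : φ a₄ = SexticD.quadraticCoeff := by simp [φ, a₄, SexticD.quadraticCoeff]
    have h₆ : φ a₆ = SexticD.constantCoeff := by simp [φ, a₆, SexticD.constantCoeff]
    simp [p, SexticD.cubic, h₂, h₄, h₆, ← pow_mul]
  rw [← MulEquiv.irreducible_iff e]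
  convert (Associated.refl p).neg_left.irreducible_iff.mpr hp using 1
  simp only [p, a₂, a₄, a₆, map_add, map_sub, map_mul, map_pow, map_ofNat, hX0, hX1, hX2]
  ring
end
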